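/- For every natural number k ≥ 1 there exists a maxnil graph with 11k + 2 vertices and 25k + 1 edges in which no edge lies in a triangle. -/

import Mathlib

open SimpleGraph

/-- `H` is a minor of `G`: there is a family of nonempty, pairwise disjoint,
connected branch sets in `G`, one for each vertex of `H`, with an edge of `G`
between the branch sets of any two adjacent vertices of `H`. -/
def IsMinor {W V : Type} (H : SimpleGraph W) (G : SimpleGraph V) : Prop :=
  ∃ f : W → Set V,
    (∀ w, (f w).Nonempty) ∧
    (∀ w, (G.induce (f w)).Connected) ∧
    (Pairwise fun w₁ w₂ => Disjoint (f w₁) (f w₂)) ∧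
    ∀ ⦃w₁ w₂⦄, H.Adj w₁ w₂ → ∃ v₁ ∈ f w₁, ∃ v₂ ∈ f w₂, G.Adj v₁ v₂

/-- The result of a `∇Y`-move on the triangle `a b c` of `G`: delete the edges of
the triangle and add a new vertex (`none`) joined to `a`, `b`, `c`. -/
def triangleY {V : Type} (G : SimpleGraph V) (a b c : V) : SimpleGraph (Option V) :=
  (SimpleGraph.map Function.Embedding.some
      (G.deleteEdges {s(a, b), s(b, c), s(a, c)})) ⊔
    SimpleGraph.fromEdgeSet {s((none : Option V), some a), s(none, some b), s(none, some c)}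

/-- Membership in the Petersen family: the graphs obtained from `K₆` by
`∇Y`-moves and `Y∇`-moves (the inverse operation), up to isomorphism. -/
inductive IsPetersenFamily : ∀ {V : Type}, SimpleGraph V → Prop
  | k6 : IsPetersenFamily (⊤ : SimpleGraph (Fin 6))
  | deltaY {V : Type} {G : SimpleGraph V} {a b c : V} :
      IsPetersenFamily G → G.Adj a b → G.Adj b c → G.Adj a c →
      IsPetersenFamily (triangleY G a b c)
  | yDelta {V : Type} {G : SimpleGraph V} {a b c : V} :
      IsPetersenFamily (triangleY G a b c) → G.Adj a b → G.Adj b c → G.Adj a c →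
      IsPetersenFamily G
  | iso {V W : Type} {G : SimpleGraph V} {H : SimpleGraph W} :
      IsPetersenFamily G → G ≃g H → IsPetersenFamily H

/-- A graph is linklessly embeddable (nIL) iff it has no minor in the Petersen family. -/
def IsLinkless {V : Type} (G : SimpleGraph V) : Prop :=
  ∀ ⦃W : Type⦄ (P : SimpleGraph W), IsPetersenFamily P → ¬ IsMinor P G

/-- The graph obtained from `G` by adding the edge `ab`. -/
def addEdge {V : Type} (G : SimpleGraph V) (a b : V) : SimpleGraph V :=
  G ⊔ SimpleGraph.fromEdgeSet {s(a, b)}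

/-- A nIL graph is maxnil if adding any edge yields a graph that is not nIL. -/
def IsMaxnil {V : Type} (G : SimpleGraph V) : Prop :=
  IsLinkless G ∧ ∀ a b : V, a ≠ b → ¬ G.Adj a b → ¬ IsLinkless (addEdge G a b)

/-- `S` is a vertex cut set of the connected graph `G` if `G - S` is disconnected. -/
def IsVertexCut {V : Type} (G : SimpleGraph V) (S : Set V) : Prop :=
  G.Connected ∧ ¬ (G.induce Sᶜ).Preconnected

/-- A vertex cut set is minimal if no proper subset of it is a vertex cut set. -/
def IsMinimalVertexCut {V : Type} (G : SimpleGraph V) (S : Set V) : Prop :=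
  IsVertexCut G S ∧ ∀ S' ⊂ S, ¬ IsVertexCut G S'

/-- A set `T` of vertices of `H` (inducing a `K₄`) is strongly separating if `H - T`
has at least two connected components such that every vertex of `T` has a
neighbor in each of them. -/
def StronglySeparating {V : Type} (H : SimpleGraph V) (T : Set V) : Prop :=
  ∃ C₁ C₂ : (H.induce Tᶜ).ConnectedComponent, C₁ ≠ C₂ ∧
    ∀ v ∈ T, (∃ u ∈ C₁.supp, H.Adj v ↑u) ∧ (∃ u ∈ C₂.supp, H.Adj v ↑u)

/-- `G` is maximal without a `K₆` minor. -/
def IsMaximalK6MinorFree {V : Type} (G : SimpleGraph V) : Prop :=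
  ¬ IsMinor (⊤ : SimpleGraph (Fin 6)) G ∧
    ∀ a b : V, a ≠ b → ¬ G.Adj a b → IsMinor (⊤ : SimpleGraph (Fin 6)) (addEdge G a b)

/-! ### General facts on minors -/

/-- `f` is a family of branch sets of `H` in `G`. -/
def Model {W V : Type} (H : SimpleGraph W) (G : SimpleGraph V) (f : W → Set V) : Prop :=
  (∀ w, (f w).Nonempty) ∧ (∀ w, (G.induce (f w)).Connected) ∧
    (Pairwise fun w₁ w₂ => Disjoint (f w₁) (f w₂)) ∧
    ∀ ⦃w₁ w₂⦄, H.Adj w₁ w₂ → ∃ v₁ ∈ f w₁, ∃ v₂ ∈ f w₂, G.Adj v₁ v₂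

/-- Induction principle along a connected set. -/
theorem conn_ind {V : Type} {G : SimpleGraph V} {S : Set V} (hS : (G.induce S).Connected)
    (P : V → Prop) (hP : ∀ a ∈ S, ∀ b ∈ S, G.Adj a b → P a → P b) {a b : V} (ha : a ∈ S) (hb : b ∈ S)
    (h : P a) : P b := by
  have hr := hS.preconnected ⟨a, ha⟩ ⟨b, hb⟩
  rw [SimpleGraph.reachable_iff_reflTransGen] at hr
  have key : ∀ x : S, Relation.ReflTransGen (G.induce S).Adj ⟨a, ha⟩ x → P x := by
    intro x hx
    induction hx with
    | refl => exact h
    | tail _ hbc ih => exact hP _ (Subtype.property _) _ (Subtype.property _) hbc ih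
  exact key _ hr

/-- A criterion for connectedness of an induced subgraph. -/
theorem conn_of_ind {V : Type} {G : SimpleGraph V} {S : Set V} (s : V) (hs : s ∈ S)
    (h : ∀ P : V → Prop, P s → (∀ a ∈ S, ∀ b ∈ S, G.Adj a b → P a → P b) → ∀ b ∈ S, P b) :
    (G.induce S).Connected := by
  have key : ∀ x : S, (G.induce S).Reachable ⟨s, hs⟩ x := by
    have := h (fun x => ∃ hx : x ∈ S, (G.induce S).Reachable ⟨s, hs⟩ ⟨x, hx⟩) ⟨hs, .refl _⟩ (by
      rintro a ha b hb hab ⟨_, hr⟩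
      refine ⟨hb, hr.trans (SimpleGraph.Adj.reachable ?_)⟩
      exact hab)
    intro x
    exact (this x x.2).2
  rw [SimpleGraph.connected_iff]
  exact ⟨fun x y => (key x).symm.trans (key y), ⟨⟨s, hs⟩⟩⟩

theorem conn_image {V V' : Type} {G : SimpleGraph V} {G' : SimpleGraph V'} {S : Set V}
    (hS : (G.induce S).Connected) (r : V → V')
    (hr : ∀ a ∈ S, ∀ b ∈ S, G.Adj a b → r a = r b ∨ G'.Adj (r a) (r b)) :
    (G'.induce (r '' S)).Connected := by
  obtain ⟨⟨s, hs⟩⟩ := hS.nonempty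
  refine conn_of_ind (r s) ⟨s, hs, rfl⟩ ?_
  rintro P hP hstep _ ⟨b, hb, rfl⟩
  refine conn_ind hS (fun x => P (r x)) ?_ hs hb hP
  intro a ha b hb hab h
  rcases hr a ha b hb hab with he | he
  · rw [← he]; exact h
  · exact hstep _ ⟨a, ha, rfl⟩ _ ⟨b, hb, rfl⟩ he h

theorem Model.trans {A B C : Type} {GA : SimpleGraph A} {GB : SimpleGraph B} {GC : SimpleGraph C}
    {f : A → Set B} {g : B → Set C} (hf : Model GA GB f) (hg : Model GB GC g) :
    Model GA GC (fun a => ⋃ b ∈ f a, g b) := by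
  obtain ⟨f1, f2, f3, f4⟩ := hf
  obtain ⟨g1, g2, g3, g4⟩ := hg
  have hne : ∀ a, (⋃ b ∈ f a, g b).Nonempty := by
    intro a
    obtain ⟨b, hb⟩ := f1 a
    obtain ⟨c, hc⟩ := g1 b
    exact ⟨c, Set.mem_biUnion hb hc⟩
  refine ⟨hne, ?_, ?_, ?_⟩
  · intro a
    obtain ⟨b, hb⟩ := f1 a
    obtain ⟨c, hc⟩ := g1 b
    refine conn_of_ind c (Set.mem_biUnion hb hc) ?_
    intro P hP hstep
    have inner : ∀ b ∈ f a, ∀ x ∈ g b, P x → ∀ y ∈ g b, P y := by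
      intro b hb x hx hPx y hy
      refine conn_ind (g2 b) P ?_ hx hy hPx
      intro u hu v hv huv
      exact hstep u (Set.mem_biUnion hb hu) v (Set.mem_biUnion hb hv) huv
    have outer : ∀ b' ∈ f a, ∀ y ∈ g b', P y := by
      intro b' hb'
      refine conn_ind (f2 a) (fun b => ∀ y ∈ g b, P y) ?_ hb hb' (inner b hb c hc hP)
      intro u hu v hv huv hall
      obtain ⟨x, hx, y, hy, hxy⟩ := g4 huv
      exact inner v hv y hy (hstep x (Set.mem_biUnion hu hx) y (Set.mem_biUnion hv hy) hxy (hall x hx))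
    intro y hy
    obtain ⟨b', hb', hy'⟩ := Set.mem_iUnion₂.1 hy
    exact outer b' hb' y hy'
  · intro a a' haa
    rw [Set.disjoint_left]
    intro c hc hc'
    obtain ⟨b, hb, h1⟩ := Set.mem_iUnion₂.1 hc
    obtain ⟨b', hb', h2⟩ := Set.mem_iUnion₂.1 hc'
    by_cases hbb : b = b'
    · subst hbb
      exact Set.disjoint_left.1 (f3 haa) hb hb'
    · exact Set.disjoint_left.1 (g3 hbb) h1 h2
  · intro a a' haa
    obtain ⟨b, hb, b', hb', hbb⟩ := f4 haa
    obtain ⟨c, hc, c', hc', hcc⟩ := g4 hbb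
    exact ⟨c, Set.mem_biUnion hb hc, c', Set.mem_biUnion hb' hc', hcc⟩

theorem minor_trans {A B C : Type} {GA : SimpleGraph A} {GB : SimpleGraph B} {GC : SimpleGraph C}
    (h : IsMinor GA GB) (h' : IsMinor GB GC) : IsMinor GA GC := by
  obtain ⟨f, hf⟩ := h
  obtain ⟨g, hg⟩ := h'
  exact ⟨_, Model.trans hf hg⟩

theorem conn_singleton {V : Type} (G : SimpleGraph V) (v : V) :
    (G.induce ({v} : Set V)).Connected := by
  refine conn_of_ind v rfl ?_
  rintro P hP - b rfl
  exact hP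

/-- An injective homomorphism gives a minor. -/
theorem minor_of_inj {A B : Type} {GA : SimpleGraph A} {GB : SimpleGraph B} (e : A → B)
    (he : Function.Injective e) (h : ∀ a b, GA.Adj a b → GB.Adj (e a) (e b)) : IsMinor GA GB := by
  refine ⟨fun a => {e a}, fun a => ⟨_, rfl⟩, fun a => conn_singleton _ _, ?_, ?_⟩
  · intro a b hab
    simpa using fun h => hab (he h)
  · intro a b hab
    exact ⟨_, rfl, _, rfl, h a b hab⟩

theorem minor_of_iso {A B : Type} {GA : SimpleGraph A} {GB : SimpleGraph B} (e : GA ≃g GB) :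
    IsMinor GA GB :=
  minor_of_inj e e.injective fun _ _ h => e.map_rel_iff.2 h

/-- Image of a model under a map that collapses little. -/
theorem Model.map {W V V' : Type} {H : SimpleGraph W} {G : SimpleGraph V} {G' : SimpleGraph V'}
    {f : W → Set V} (hf : Model H G f) (r : V → V')
    (hr : ∀ a b, G.Adj a b → r a = r b ∨ G'.Adj (r a) (r b))
    (hd : ∀ w w' a b, a ∈ f w → b ∈ f w' → r a = r b → w = w') :
    Model H G' (fun w => r '' f w) := by
  obtain ⟨f1, f2, f3, f4⟩ := hf
  refine ⟨fun w => (f1 w).image r, fun w => conn_image (f2 w) r fun a _ b _ h => hr a b h, ?_, ?_⟩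
  · intro w w' hw
    rw [Set.disjoint_left]
    rintro _ ⟨a, ha, rfl⟩ ⟨b, hb, hab⟩
    exact hw (hd w w' a b ha hb hab.symm)
  · intro w w' hw
    obtain ⟨a, ha, b, hb, hab⟩ := f4 hw
    refine ⟨r a, ⟨a, ha, rfl⟩, r b, ⟨b, hb, rfl⟩, ?_⟩
    rcases hr a b hab with h | h
    · exact absurd (hd w w' a b ha hb h) hw.ne
    · exact h

theorem Model.exists_rep {W V : Type} {H : SimpleGraph W} {G : SimpleGraph V} {f : W → Set V}
    (hf : Model H G f) : ∃ h : W → V, Function.Injective h ∧ ∀ w, h w ∈ f w := by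
  choose h hh using hf.1
  refine ⟨h, ?_, hh⟩
  intro a b hab
  by_contra hne
  exact Set.disjoint_left.1 (hf.2.2.1 hne) (hh a) (hab ▸ hh b)

theorem minor_card {W V : Type} [Fintype W] [Fintype V] {H : SimpleGraph W} {G : SimpleGraph V}
    (h : IsMinor H G) : Fintype.card W ≤ Fintype.card V := by
  obtain ⟨f, hf⟩ := h
  obtain ⟨h, hi, _⟩ := Model.exists_rep hf
  exact Fintype.card_le_of_injective h hi

/-- A minor with all vertices is a subgraph. -/
theorem minor_spanning {W V : Type} [Fintype W] [Fintype V] {H : SimpleGraph W} {G : SimpleGraph V}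
    (hm : IsMinor H G) (hc : Fintype.card W = Fintype.card V) :
    ∃ h : W → V, Function.Injective h ∧ ∀ a b, H.Adj a b → G.Adj (h a) (h b) := by
  obtain ⟨f, hf⟩ := hm
  obtain ⟨h, hi, hh⟩ := Model.exists_rep hf
  have hb : Function.Bijective h := (Fintype.bijective_iff_injective_and_card h).2 ⟨hi, hc⟩
  have hs : ∀ w, ∀ v ∈ f w, v = h w := by
    intro w v hv
    obtain ⟨w', rfl⟩ := hb.2 v
    by_contra hne
    have : w' ≠ w := fun e => hne (by rw [e])
    exact Set.disjoint_left.1 (hf.2.2.1 this) (hh w') hv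
  refine ⟨h, hi, ?_⟩
  intro a b hab
  obtain ⟨x, hx, y, hy, hxy⟩ := hf.2.2.2 hab
  rw [← hs a x hx, ← hs b y hy]
  exact hxy

/-- The contraction step. -/
theorem minor_step {W V : Type} [Fintype W] [Fintype V] {H : SimpleGraph W} {G : SimpleGraph V}
    (hc : Fintype.card W < Fintype.card V) (hi : ∀ v, ∃ u, G.Adj v u)
    (hs : ∀ u v, G.Adj u v → ∃ (V' : Type) (G' : SimpleGraph V') (r : V → V'),
      (∀ a b, r a = r b → a = b ∨ (a = u ∧ b = v) ∨ (a = v ∧ b = u)) ∧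
      (∀ a b, G.Adj a b → r a = r b ∨ G'.Adj (r a) (r b)) ∧ ¬ IsMinor H G') :
    ¬ IsMinor H G := by
  rintro ⟨f, hf⟩
  have hm : Model H G f := hf
  have hdis : ∀ w w' a, a ∈ f w → a ∈ f w' → w = w' := by
    intro w w' a ha ha'
    by_contra hne
    exact Set.disjoint_left.1 (hm.2.2.1 hne) ha ha'
  have key : ∃ u v, G.Adj u v ∧ ((∃ w, u ∈ f w ∧ v ∈ f w) ∨ ∀ w, u ∉ f w) := by
    by_cases hu : ∃ u, ∀ w, u ∉ f w
    · obtain ⟨u, hu⟩ := hu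
      obtain ⟨v, hv⟩ := hi u
      exact ⟨u, v, hv, Or.inr hu⟩
    · push Not at hu
      choose g hg using hu
      obtain ⟨x, y, hxy, he⟩ := Fintype.exists_ne_map_eq_of_card_lt g hc
      by_contra hno
      push Not at hno
      have : y = x := by
        refine conn_ind (hm.2.1 (g x)) (fun z => z = x) ?_ (hg x) (he ▸ hg y) rfl
        intro a ha b hb hab _
        exact absurd hb ((hno a b hab).1 _ ha)
      exact hxy this.symm
  obtain ⟨u, v, huv, hcase⟩ := key
  obtain ⟨V', G', r, h1, h2, h3⟩ := hs u v huv
  refine h3 ⟨_, Model.map hm r h2 ?_⟩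
  intro w w' a b ha hb hab
  rcases hcase with ⟨w₀, hu, hv⟩ | hno
  · rcases h1 a b hab with rfl | ⟨rfl, rfl⟩ | ⟨rfl, rfl⟩
    · exact hdis _ _ _ ha hb
    · rw [hdis _ _ _ ha hu, hdis _ _ _ hb hv]
    · rw [hdis _ _ _ ha hv, hdis _ _ _ hb hu]
  · rcases h1 a b hab with rfl | ⟨rfl, rfl⟩ | ⟨rfl, rfl⟩
    · exact hdis _ _ _ ha hb
    · exact absurd ha (hno _)
    · exact absurd hb (hno _)

def lvT5 : List (ℕ × List ℕ) := [(202920658782515953694, [])]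

def lvT6 : List (ℕ × List ℕ) := [
  (25388272321864707466919998, [4399360, 3280960, 3277120, 4206880, 274720, 4399376, 4399392, 3281216,
    4272416, 1323296, 4403488, 4469024]),
  (27806123961093961523462202, [4399360, 3408160, 4203280, 274720, 4399376, 3212290, 201730, 3412256,
    4399888, 1323296, 3216386, 3347458])]

def lvT7 : List (ℕ × List ℕ) := [
  (3248462258276027034070836641918, [70329600, 88285200, 88212240, 88089360, 84156720, 5513520, 88285456,
    70329632, 88285488, 88285712, 88220432, 86253872, 39067952, 88351024, 89399600]),
  (3882280305941997166338043084926, [88224000, 88215600, 88211760, 88092960, 84153120, 5509920, 88216368,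
    88224048, 88224032, 86250272, 88215856, 88216112, 88347424, 72618784, 89396000]),
  (3406918583341448915999089557622, [88285440, 70328400, 72360240, 17114160, 5514000, 356720912, 88285472,
    290726672, 70328912, 356721424, 72491312, 19211312, 39068432, 356786960, 357835536]),
  (2773081193415717732478046765174, [88158720, 88158240, 18892080, 17048880, 273884176, 88154912,
    18895875, 17060355, 290661392, 88159008, 19158019, 19157507, 19154224, 19146032, 357770256]),
  (1505360477113250931660333842558, [68375040, 21188640, 22152240, 88085280, 84153120, 5509680, 68375072,
    22164528, 88216352, 55841328, 22168624, 72487472, 87298848, 88347424, 72618544])]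

def lvT8 : List (ℕ × List ℕ) := [
  (420590069026431166926589949158162686, [1092838656, 1698897936, 1698890256, 1698705936, 5133919552,
    5911097872, 4401148432, 1698898192, 1698894352, 1092838704, 5990789648, 1698898448, 1698898704,
    5134968128, 5978206736, 5474890256, 5994983952, 6011761168]),
  (430974662745918802954592444615295214, [1698898176, 1164124176, 1410531936, 1443041856, 543376656, 106107936,
    10288828944, 1698898224, 8964482064, 10288833040, 1164124944, 10288833552, 1410544224, 1446187584,
    593708304, 911414304, 10289882128, 10306659344]),
  (514050144979360653159460935543881974, [5135291392, 5742206992, 1445990976, 1443041856, 14501032464,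
    12986758464, 5742203408, 4882457921, 5134181377, 13259518480, 5742207504, 4882523457, 4882522177,
    1446056512, 1446064704, 14584918544, 13255193920, 14601695760]),
  (181733321740979916155647845901861110, [5993865472, 5742206992, 640697616, 637809936, 14501032464,
    12991082784, 18878763536, 18085991457, 5134181377, 13527953696, 18878767632, 18086122529, 4882522177,
    14534586896, 640959760, 640955664, 14584918544, 14333260064]),
  (430974662745918655376136263901708526, [1698898176, 1164124176, 10288824848, 5738082832, 18795999760,
    4401148192, 14265049360, 10288828944, 1698898224, 13222765840, 10288833040, 1164124944, 13997663504,
    5742277136, 18863108624, 5474890016, 13994517776, 14028072208]),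
  (514050461890801784397196955422884054, [5993865472, 5742206992, 10287588368, 14501032464, 12991082784,
    13995742480, 13477372164, 5134181377, 8695988993, 13995758864, 13477437700, 4882522177, 10256270081,
    10287719440, 10287723536, 14584918544, 14333260064, 10306601729]),
  (514050144979360634712716870424527078, [5135291392, 5742206992, 4883633153, 5993865477, 5742207237,
    5738012948, 5742203408, 4882457921, 5134242817, 4400029957, 5742207504, 4882523457, 5738012692,
    4882588993, 4882564417, 5977088261, 5473771781, 6010642693]),
  (514050144993868261057207753206726894, [1697780736, 4882583873, 5742134032, 1443107376, 18811790081,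
    17553498881, 4882584641, 5742138128, 5742076688, 1694765571, 17285063425, 4882584897, 5742142224,
    4882564417, 5742273296, 18862121729, 18358805249, 18895676161]),
  (181733638668137581128759161372082414, [5993796352, 18086183201, 5742134032, 5201281552, 18811790081,
    17553490721, 18086183457, 5675287297, 18878636816, 5184569857, 17821926177, 18086183969, 18878702352,
    5687870017, 18828567297, 18878833424, 18862121729, 18358797089]),
  (503667135837632256932778581494137070, [14580662784, 1697910816, 1666449696, 1694765856, 1616130336,
    12954325344, 14580662816, 14580662848, 18857927217, 5993734448, 18795012145, 5978001968, 18857919025,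
    5993931056, 5978198576, 18862121009, 13491196256, 14028067168]),
  (586742301006104709453413589610987774, [5742080512, 840192096, 1446248736, 5993672992, 1443115296,
    5911093552, 106173216, 5742080544, 5742080560, 1446252832, 5742080288, 1446253344, 5742072368,
    5134963808, 5474885936, 5994979632, 1448350496, 6011756848]),
  (524432520247434152990198296002494702, [4886777873, 1446121536, 1158808416, 1694765856, 18811789361,
    4619386913, 4886777857, 4886777937, 1158807651, 1447236384, 1694765091, 18795012145, 4350951457,
    1447105312, 4886773841, 1447301920, 18358804529, 18895675441]),
  (597126894723174383156937181011706086, [5742080512, 5474693152, 4883506433, 13492379908, 4616118353,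
    5469516053, 14328996896, 5742080528, 4399968517, 14329005088, 5474693408, 5469515797, 14329000992,
    4882195777, 4347421777, 13475602692, 5473710341, 13458825476]),
  (430972127372182815774099894888104190, [1698894336, 342052896, 1164116496, 1163932176, 1443045696, 543380496,
    106119456, 1445139520, 1698894384, 308499472, 1445138752, 342053664, 1164128784, 1445142848, 1446191424,
    593712144, 911425824, 576934928])]

def lvT9 : List (ℕ × List ℕ) := [
  (54787293968135359541689357188510879384062, [31763669248, 17768534128, 31763661088, 31763472688, 31759417648,
    13423236208, 12919919728, 840324208, 31763669264, 31763669296, 31763665184, 31763538224, 921023239200,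
    13490345072, 31763603760, 31763611952, 13440013424, 13188355184, 5135291504, 13456790640, 13725226096]),
  (55467858701977237677541926299469996425686, [31763669248, 23207288848, 100482953744, 169119855120, 236329382416,
    139172524320, 306641572368, 306637255188, 31759413508, 349877580304, 306641576464, 306637320724,
    23203033108, 375311839760, 100483150352, 100483154448, 169203741200, 237671559696, 160647360800,
    375378948624, 375647384080]),
  (66356728309437401118119425732908481315278, [13445187328, 169202622480, 9418639168, 169117819920, 288071436033,
    280018372353, 444080529680, 426315679569, 512796930576, 13428540673, 275723405057, 444080529936,
    169202623504, 426315351889, 512799027728, 9401992513, 169201574928, 169201706000, 288339871489,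
    284313339649, 288608306945]),
  (22799297653936361157555636447349522629070, [13445187328, 237922099216, 9418639168, 237837296656, 288071436033,
    280018356033, 490723561475, 490756658945, 581516407312, 13428540673, 292903257921, 490723562755,
    237922100240, 490756986625, 581518504464, 9401992513, 288876742401, 237921051664, 237921182736,
    288339871489, 284313323329]),
  (76565199319125868059061591378388700692974, [169199485440, 9416564848, 27721269808, 13438903408, 27654361648,
    648646242832, 207806993776, 169199485472, 169199485504, 512796930848, 718958375440, 787628700176,
    27721273904, 512796922656, 718958506512, 27721470512, 512801124640, 641935356432, 650256855568,
    216396928368, 650525291024]),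
  (77245764052967746194914160207872840499662, [169199485440, 284294602832, 769073292866, 27653182288, 369406186608,
    207808042096, 284278802241, 169199485456, 284278802209, 631634355778, 284294604624, 631634354242,
    216446080832, 495079261985, 284294408016, 216446342976, 27649053268, 229282878576, 369943057520,
    275688867617, 371016799344]),
  (77245764052650833544801762624942528856542, [9416566528, 284294602832, 778513229426, 710401863968, 787628699906,
    305047872272, 1984238368, 284294604112, 229280847632, 9416566592, 229280847696, 284294604368,
    646212432160, 778513221234, 710402126112, 646212563232, 787589706834, 19164107552, 306658485008,
    216395945808, 306926920464]),
  (66356936003134215109328900029064282440078, [650238959872, 369991172208, 306625774352, 287801894672,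
    344708159328, 370746331143, 306122334977, 288305334017, 344204596998, 370746331399, 369991172464,
    637356998962, 375358956560, 296389510982, 361370052368, 296892766052, 375362102288, 361366906640,
    622777951282, 353298093920, 352794531590]),
  (77245764052967746194914159926406453985734, [169199485440, 284294602832, 169119724560, 371332432135,
    280016281713, 414013669655, 284278802241, 444077392400, 139135762695, 631634355778, 856397328912,
    710282391623, 284278810433, 631634351682, 856397459984, 284278417217, 700348527938, 275717121137,
    370795561223, 139053905175, 371063996679]),
  (77245764053284649173527776159930448150990, [27721278208, 284278812993, 229280843536, 9396643648, 305284850433,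
    207807010576, 284278813761, 486496666115, 494479439440, 512796930576, 764779385891, 284278814529,
    646212432160, 778504118531, 646212497696, 494479177296, 512801124880, 646214594848, 306090156801,
    503675556355, 306895463169]),
  (77245764053284658844897448596015680389582, [512796930560, 631634354754, 778513229426, 787628699906,
    636298395954, 481624872560, 631634355266, 486496666115, 512796930576, 486496666131, 631634355778,
    646212432160, 485924034160, 778504118531, 646212497696, 646212563232, 512801124880, 485919839856,
    637372137778, 503676535315, 636835266866]),
  (66356728311338948345158896060102450938350, [13444081408, 27718135888, 787590882386, 718954173248, 27652072528,
    287801894672, 275707618592, 169200533776, 9417549632, 169200533840, 280017266448, 169200534544,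
    27718136144, 787590886482, 169200526352, 718956270400, 925101208080, 169203672080, 288338765584,
    280002585888, 288607201040]),
  (36410800023124144410729568086339590095326, [306389848832, 285166997552, 26126451568, 706107941168, 787091751266,
    769408828946, 689179992848, 306389848848, 306389848944, 285166997808, 285166999344, 142341396080,
    923976025440, 160024319840, 779117146434, 215087142752, 787142082914, 770214135314, 757894296594,
    215892449120, 215858894688])]

def lvT10 : List (ℕ × List ℕ) := [
  (7203380599902409251192844852681726945328956302, [581519483136, 1681031110672, 444617392416, 2778950021648,
    3850275926544, 2231341683248, 2359035453443, 2359068485633, 3458573232129, 86712538626, 1117538113537,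
    2359035454979, 1681031111696, 2359068878849, 3458579523585, 223614600786, 1388657924097, 1681030063120,
    1681030194192, 2780560634384, 3876045730320, 2643658543664, 1388121053185, 1392416020481]),
  (10057854210067437183581858332417392739930669966, [4979565994240, 6079077621776, 7178589241872, 12674554671632,
    8248322437648, 5942172385862, 9377612505360, 10477124006416, 2780475765264, 5529271488776, 9377612505616,
    6079077622544, 11576635765264, 8828327515174, 6674521130067, 6077398852694, 10110461445441, 8828323320870,
    6077395706966, 4977868350550, 5529771660326, 8278387208720, 5941588349192, 8282682176016])]

def lvN9 : List (ℕ × List ℕ) := [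
  (68398604241590913803322242540552772714798, [147106174327, 27233693728, 27704688928, 160575209760, 139172462880,
    164035168117, 164035168005, 147106174215, 151739461665, 18529792033, 167577464865, 91291124279,
    23135913748, 18529780513, 139340415780, 155163513187, 168852198435, 232315421477, 9452192791,
    70334617394, 169469018977]),
  (55467775625306586632463558723798186131854, [27186635008, 168949981200, 165143642640, 81645687824, 70453039664,
    10573135873, 164137009665, 23090106883, 138603075330, 31195463713, 152022556785, 31145144353,
    87365255969, 83567707154, 27186897200, 163281138225, 164551225875, 138882065175, 163214275185,
    32016576530])]

def lvN10 : List (ℕ × List ℕ) := [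
  (7203369710908187617012615895216572212012974990, [2643640529408, 4965570797680, 4965570774640, 2641493045888,
    2544605082128, 2230787256848, 4484541802352, 4484541806192, 2578162135553, 2707238760968, 2221696102913,
    4484541802096, 4965570798960, 4965570795120, 2497112977936, 2501690012176, 2495499743873, 2570341331472,
    2561784951312, 2706975568512, 2501622903312, 2560982790657, 2492531749377]),
  (3010656072230523125405251219413626309187535646, [3802725888392, 3798364141592, 5997974652176, 3802725888384,
    3781251381264, 5515334022416, 3798447700097, 5998024787201, 3802659041544, 3781268092929, 5515384157441,
    5993729884241, 3798447698049, 3798364139544, 5511089254481, 11164840252176, 5798798651776, 6005759230336,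
    5798832075016, 5794503751696, 6005792653576, 6001464330256, 11370196509456]),
  (4393315205352501401838589503531258799410971438, [3655558698632, 2703283589168, 2780526871328, 3673875288624,
    3643884704304, 2230838182688, 6972351124004, 6972351123988, 3655558698504, 5923384856696, 173783921168,
    2551549822576, 2574430437668, 2758175688308, 6945569773168, 3673883677232, 3678109962804, 5941421609536,
    2695228560976, 3678244442672, 2208419907188, 6949864740464, 4337395011]),
  (7203369710908186666274664506559412499532022670, [2643640594688, 3540433399824, 3806821745424, 2641497366848,
    3815378137112, 2230787256608, 3524059885569, 1204576072240, 2643636461828, 4407463274245, 1204576068144,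
    4965570798960, 3806821758992, 5782774306576, 2570345525776, 4682876807040, 2570341331472, 3506069468184,
    2706975568512, 2501622903312, 3797930883073, 5645030332483]),
  (7203369710851072351561476284914442120316912398, [2707310190848, 3876012105744, 5781972256016, 2405860467728,
    3876012105752, 2341702426628, 4548714325765, 2642570981952, 3330298492929, 1681031111184, 3608399605809,
    3605172203649, 3603567902769, 1681031115280, 5873468572721, 4609715757093, 2707171778948, 6942647398722,
    3805346474004, 3601134198808, 7027726233976, 3592578146323]),
  (7203369710908186666281918061486107473832903566, [1204576072192, 3745836634224, 3734543466864, 2641497366848,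
    2681001297248, 2230791184688, 1204576072224, 1204576072240, 1204576072208, 2372238966833, 4965570803040,
    2440891351073, 2547589842788, 3459135275312, 2505669357856, 6628298752561, 3459131081008, 3437668799544,
    3457455440184, 2776567648816, 2286087012402, 4763439859815]),
  (7270271946441471924123921816197707824534192574, [3876012105984, 2630535549008, 156085268499, 3608399606544,
    2570403853328, 2778934100768, 2337409425728, 2410153467908, 5714055992592, 3876012106112, 4965570803040,
    156352644627, 2505668899872, 4965303408480, 156085280787, 3582948041072, 2570412241936, 6942647399457,
    3805346472264, 3601134526768, 7027726759681, 3300520108344]),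
  (7270263779825625122526707637034436146043355438, [1655259281152, 2410959814688, 2633220883568, 156082135059,
    4811038856560, 3742077421697, 3742077421569, 5873472766801, 3454855577649, 3470425210929, 2208810041393,
    3454856101937, 2479639431203, 2410825582628, 3438212940849, 5946114917667, 6014566941971, 4484063724850,
    4614227689800, 448661828112, 3747446129777, 4763958904935])]

def lvN11 : List (ℕ × List ℕ) := [
  (939775547535079694608014103662230887425938550490894, [150042889499648, 21046790492176, 54530355233568,
    148985523356048, 27506989478416, 53431378383648, 21046790492432, 90458043252995, 213619112445702,
    149006914306313, 211261683234822, 63253682205456, 63253682205200, 178484133980161, 10477124203024,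
    202389937796960, 147851457008672, 164378716554129, 147851389899808, 167153418715929, 150037537690768,
    146751895049248, 167127749575569, 179445111031558]),
  (939775547535079632301560981010765900873592542136078, [63253682139648, 254624538894464, 255595001283344,
    148985588433488, 162281404129353, 141319076065808, 72123076063776, 63253682139664, 72123076063760,
    98438054355472, 166448658989440, 180673051066465, 167635075680528, 98438054359568, 165444641297440,
    166448659513728, 146816638390832, 196955474593392, 160972513972544, 162006526222409, 162938535440425,
    159652879229065, 161993927000129, 160684207212896]),
  (939775547535079694608489472637427176433940203112206, [98438054293760, 98438054293520, 253202601674864,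
    161943124379673, 167758490895993, 141255406461968, 98438054293776, 90458043252995, 90458043253027,
    98438054294288, 98438054294032, 144681752068418, 160809273038688, 167634069066768, 186033623885936,
    144407948493122, 160817820993385, 160809264650080, 167634001957904, 167208735082105, 161788573778249,
    151151011111952, 167200178738800, 177108650887046]),
  (939775547535079777685873194071774033067536310142734, [10477124002560, 165083830648944, 186033624189040,
    148985522373008, 147370890445088, 141319013081408, 180673051068001, 10477124006416, 168579194950803,
    167635075679248, 180673051066465, 186033624213616, 165083830622320, 10477124203024, 166581803500128,
    146679736254752, 147852463653152, 146649628873778, 147851389911328, 144178874316880, 165407916110889,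
    143216281487200, 167127756718929, 146606427542578]),
  (942698573110486621091700912980637947822542196377022, [254624538896384, 114978258759696, 110394240729936,
    249972573372944, 147989356298768, 142489943168048, 148848686351648, 141388266284048, 213593443763808,
    255458099212592, 249126179074448, 251338894283552, 108406959780368, 217227435862128, 111495356687168,
    249959739392528, 146679736308512, 160877715752560, 162890937107289, 361015175356720, 167473983334240,
    159652879231120, 162728366146329, 151283870934032]),
  (384382134335847242226969203767880100143537486366254, [163150087422873, 28069310115856, 248804611195184,
    248778834080144, 247425926775344, 17808633596176, 28068775342081, 248805145968899, 248777497145609,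
    247426461549059, 17808098822401, 28069310116368, 21519518761744, 183864414771296, 201800131351392,
    162738044502929, 162737777115929, 162944169509009, 163279204930449, 162943902122009, 196903868925792,
    163277600609049, 184792128239456, 20420007133968]),
  (942698573102320005244899315766458784550863705539886, [165444644442624, 22507074752656, 162878405972073,
    111495354590016, 165408405657984, 158911191815184, 80845868310529, 116030240391426, 201659789939552,
    26751045542192, 125999145824784, 22370178896432, 164482047411009, 164408666096409, 163966660182849,
    76310982431554, 130260218807379, 198566662571297, 198150035932457, 45528638566928, 198145758266657,
    42298600719443, 201649589393792, 200558130860912]),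
  (942697502685606039064423620840835192710553769149742, [148856389572608, 167217880647993, 143165897638208,
    249959698498064, 354662401540880, 140967377707328, 161942402531605, 133622426435842, 162797101351705,
    254560081813529, 159744974135605, 144200700003353, 130260185252947, 166376356005408, 146400294277952,
    145363293987113, 356280978933605, 161165176309360, 167761742735200, 160877416908400, 167473983334240,
    38780191281440, 163385791836768, 159521635836985]),
  (939775547535079694608489464174946428998402458847022, [18908145223936, 254419185832064, 253202601674864,
    151149932127248, 166478606321673, 106689444857136, 141319075926848, 54530355241776, 54530355241760,
    18908145223952, 255595001357072, 216816729614208, 167634069066768, 186033623885936, 144416504881472,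
    150719833663600, 160809264650080, 143380328296768, 146390505842800, 166438610483289, 151151011111952,
    167200178738800, 70375597036594]),
  (939775547535419976975410406265150369524627382011406, [27644395000576, 19264660738096, 21055346837776,
    27524102234896, 18220449104176, 55282227548163, 213593443301382, 220384856326662, 52886170452483,
    55273671163923, 80845866283536, 92730366624035, 161942286501969, 168605215892499, 163380663952659,
    163992320873619, 163966651765779, 167632575927189, 167153418978129, 167606906819349, 72791733274896,
    89062999741475, 52817484399123]),
  (942698573110486698975519976584967747917272461411606, [254419185833984, 27644394999856, 255458099077424,
    109127979798816, 52886170452768, 19264660738051, 57682896683778, 116030236274946, 248509347758339,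
    27644395000112, 19320495505667, 57545994535698, 133622394007810, 164482047288129, 163380663952209,
    168806710395669, 163966651765569, 162890937537369, 160560382034709, 162865268429649, 126741103808800,
    160530434708244, 52817484399393])]

def lvN12 : List (ℕ × List ℕ) := [
  (122890916191081673494680292629285666391302189423273512462, [186398984450560, 467873959260176, 2438198798254608,
    2271605072300448, 299291128596896, 11649936528160, 3263860056596752, 186398984450576, 2562516912976400,
    3405781950280480, 467873959260688, 749348938002960, 3228829197013552, 3545335066800656, 3246955099202416,
    1030823915827728, 3255835486992256, 864440910580128, 3151287590492272, 3397715436664976, 301490151852448,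
    582961370466720, 20002827110816, 3416407432399120, 3115076490262672]),
  (123082479595191546932878004211360661014971641472366742062, [467873959260416, 338810232217616, 2309345808875808,
    1312298887295504, 1183097723396384, 2263449750221328, 2719673774972929, 3001148751680016, 1585051075883536,
    1464920878194976, 2835938577850656, 76310992912945, 1875248812405264, 376550956471106, 2156723302576656,
    3160156424017792, 3265692427499632, 3100040395571802, 3155689659340672, 3170400583353642, 2027870009008416,
    3261225662822512, 1746382684266784, 299112670319666, 728121033505])]

def lvN13 : List (ℕ × List ℕ) := [
  (16101281065260608925893568623164319513991941933341710545654794, [3282623728394496, 7786223355757072,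
    5084943188644912, 205163983024656, 620495948656641, 5724575525507587, 5070146205494017, 920735923765266,
    6024815488081972, 4708763610394657, 1220975898132771, 6325055261901637, 1521215860642356, 6625292015645782,
    1821455633425221, 6925480448181607, 2121692370580566, 7224895741384312, 2421880537695591, 5682418021926757,
    2721291584165496, 5350295430788692, 580592228328771, 4539933599950147, 282276398519346, 12822748939041])]

def petN : List ℕ := [37477567420506345890971710, 554634615167270869762695495800,
    129807976097988053177920664777523424,
    290769178838295423044495475878658168, 65676002603697240653360349156322904965390, 4753790093746500224795451064380,
    8920484557145290528987446919554991415570268294]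

def petn : List ℕ := [6, 7, 8, 8, 9, 7, 10]

def yCerts : List (ℕ × ℕ × ℕ × ℕ × ℕ × ℕ) := [
  (0, 0, 1, 2, 1, 104091666),
  (0, 0, 1, 3, 1, 104072466),
  (0, 0, 1, 4, 1, 103826706),
  (0, 0, 1, 5, 1, 100877586),
  (0, 0, 2, 3, 1, 104071506),
  (0, 0, 2, 4, 1, 103825746),
  (0, 0, 2, 5, 1, 100876626),
  (0, 0, 3, 4, 1, 103814226),
  (0, 0, 3, 5, 1, 100865106),
  (0, 0, 4, 5, 1, 100742226),
  (0, 1, 2, 3, 1, 104071461),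
  (0, 1, 2, 4, 1, 103825701),
  (0, 1, 2, 5, 1, 100876581),
  (0, 1, 3, 4, 1, 103814181),
  (0, 1, 3, 5, 1, 100865061),
  (0, 1, 4, 5, 1, 100742181),
  (0, 2, 3, 4, 1, 103813701),
  (0, 2, 3, 5, 1, 100864581),
  (0, 2, 4, 5, 1, 100741701),
  (0, 3, 4, 5, 1, 100737861),
  (1, 0, 3, 4, 2, 1733370688),
  (1, 0, 3, 4, 2, 1985167648),
  (1, 0, 3, 5, 2, 1729438528),
  (1, 0, 4, 5, 2, 1729254208),
  (1, 1, 3, 4, 2, 1733370628),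
  (1, 1, 3, 5, 2, 1729438468),
  (1, 1, 4, 5, 2, 1729254148),
  (1, 2, 3, 4, 2, 1733369908),
  (1, 2, 3, 5, 2, 1729437748),
  (1, 2, 4, 5, 2, 1729253428),
  (1, 3, 4, 5, 3, 1728127813),
  (1, 3, 4, 5, 3, 1983139858),
  (2, 1, 3, 5, 4, 35769184611),
  (2, 1, 3, 5, 4, 23691555126),
  (2, 1, 3, 5, 4, 19412312631),
  (2, 1, 3, 5, 4, 31726927956),
  (2, 1, 3, 5, 4, 27701379141),
  (2, 1, 3, 5, 4, 14864699976),
  (2, 1, 4, 5, 4, 35769491811),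
  (2, 2, 3, 5, 4, 35769185811),
  (2, 2, 4, 5, 4, 35769493011),
  (4, 0, 1, 2, 6, 27171000855),
  (4, 0, 1, 2, 6, 412879197495),
  (4, 0, 1, 2, 6, 619032437895),
  (4, 0, 1, 2, 6, 275541023025),
  (4, 0, 1, 2, 6, 344255448705),
  (4, 0, 1, 2, 6, 164670029955),
  (4, 0, 1, 2, 6, 498540381705),
  (4, 0, 1, 2, 6, 96428262405),
  (4, 0, 1, 2, 6, 208064054370),
  (4, 0, 1, 2, 6, 551658206610),
  (5, 0, 2, 4, 2, 20268583),
  (5, 0, 3, 4, 2, 20276263),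
  (5, 0, 4, 5, 2, 23409703),
  (5, 1, 2, 4, 2, 20268658),
  (5, 1, 3, 4, 2, 20276338),
  (5, 1, 4, 5, 2, 23409778),
  (5, 2, 4, 6, 2, 102049588),
  (5, 3, 4, 6, 2, 102068788),
  (5, 4, 5, 6, 2, 108335668)]

def kCerts : List (List (Bool × List (List ℕ))) := [
  [(true, [[1], [2], [3], [4], [5]]),
    (true, [[0], [2], [3], [4], [5]]),
    (true, [[0], [1], [3], [4], [5]]),
    (true, [[0], [1], [2], [4], [5]]),
    (true, [[0], [1], [2], [3], [5]]),
    (true, [[0], [1], [2], [3], [4]])],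
  [(true, [[6, 1], [2], [3], [4], [5]]),
    (true, [[6, 0], [2], [3], [4], [5]]),
    (true, [[6, 0], [1], [3], [4], [5]]),
    (false, [[0], [1], [2], [4], [5], [6]]),
    (false, [[0], [1], [2], [3], [5], [6]]),
    (false, [[0], [1], [2], [3], [4], [6]]),
    (false, [[0], [1], [2], [3], [4], [5]])],
  [(true, [[6, 1], [2], [7, 3], [4], [5]]),
    (false, [[6, 0], [3], [4], [2], [5], [7]]),
    (false, [[6, 0], [3], [4], [1], [5], [7]]),
    (false, [[7, 0], [1], [2], [4], [5], [6]]),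
    (false, [[7, 0], [1], [2], [3], [5], [6]]),
    (false, [[6, 0], [3], [4], [1], [2], [7]]),
    (false, [[5, 0], [3], [4], [1], [2], [7]]),
    (false, [[5, 0], [1], [2], [3], [4], [6]])],
  [(false, [[1], [2], [7], [3], [4], [5]]),
    (false, [[0], [2], [7], [3], [4], [5]]),
    (false, [[0], [1], [7], [3], [4], [5]]),
    (false, [[0], [1], [2], [4], [5], [6]]),
    (false, [[0], [1], [2], [3], [5], [6]]),
    (false, [[0], [1], [2], [3], [4], [6]]),
    (false, [[0], [1], [2], [3], [4], [5]]),
    (false, [[0], [1], [2], [3], [4], [5]])],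
  [(false, [[5], [1], [8, 6], [2], [7], [4, 3]]),
    (false, [[8], [2], [4, 3], [7, 5], [0], [6]]),
    (false, [[8], [1], [5, 3], [6, 4], [0], [7]]),
    (false, [[8], [4, 1], [5, 2], [0], [7], [6]]),
    (false, [[8], [5], [1], [6, 2], [3, 0], [7]]),
    (false, [[8], [4], [2], [7, 1], [3, 0], [6]]),
    (false, [[5], [4, 1], [8, 0], [2], [7], [3]]),
    (false, [[1], [6], [3], [4], [5, 2], [8, 0]]),
    (false, [[5], [4], [0], [7, 1], [6, 2], [3]])],
  [(false, [[1], [4], [6], [2], [3], [5]]),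
    (false, [[0], [4], [6], [2], [3], [5]]),
    (false, [[0], [1], [6], [3], [4], [5]]),
    (false, [[0], [1], [6], [2], [4], [5]]),
    (false, [[0], [1], [6], [2], [3], [5]]),
    (false, [[0], [1], [6], [2], [3], [4]]),
    (false, [[0], [1], [4], [2], [3], [5]])],
  [(false, [[7, 6], [4, 1], [8], [9], [5], [3, 2]]),
    (false, [[2, 0], [9], [6, 5], [7], [4, 3], [8]]),
    (false, [[1, 0], [6], [9], [8, 5], [7], [4, 3]]),
    (false, [[2, 0], [9], [6, 5], [7], [4, 1], [8]]),
    (false, [[1, 0], [6], [8], [5], [3, 2], [9, 7]]),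
    (false, [[1, 0], [9], [6, 3], [4], [8, 2], [7]]),
    (false, [[7, 0], [4], [8], [9], [3, 2], [5, 1]]),
    (false, [[1, 0], [6, 3], [8], [9, 4], [5], [2]]),
    (false, [[2, 0], [6], [9, 4], [7], [5, 1], [3]]),
    (false, [[7, 0], [5], [3], [6], [8, 2], [4, 1]])]]

def qCerts : List (ℕ × List (List ℕ)) := [
  (2, [[11, 1], [2], [3, 4], [0, 10, 7], [5, 8], [12, 6, 9]]),
  (4, [[4, 0], [2, 1], [3, 7, 6], [5, 8], [12, 9], [10, 11]]),
  (5, [[10, 0], [2, 3], [7, 4], [5, 8], [1, 11], [6, 9, 12]]),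
  (6, [[9, 12, 2], [4, 3], [6], [5, 8], [7, 10], [0, 1, 11]])]
/-- Automorphisms of the Petersen graph. -/
def pAut : List ℕ := [313893545760,
  426680751105,
  637888062210,
  4971795555,
  434639405460,
  637839802725,
  314379929430,
  290315130375,
  4886848920,
  371551438665]

/-- The code of the circulant graph `C₁₃(1,3)`. -/
def qN : ℕ := 16101281065260608925893568623164319513991941933341710545654794

/-! ### Executable checks on graphs coded as natural numbers -/

/-- Bit `16 i + j` of the code `N`. -/
def tb (N i j : ℕ) : Bool :=
  Nat.beq (Nat.land (Nat.shiftRight N (Nat.add (Nat.mul 16 i) j)) 1) 1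

/-- Hexadecimal digit number `i` of `c`. -/
def dg (c i : ℕ) : ℕ := Nat.land (Nat.shiftRight c (Nat.mul 4 i)) 15

/-- All numbers below `n` satisfy `p`. -/
def allB : ℕ → (ℕ → Bool) → Bool
  | 0, _ => true
  | n + 1, p => bif p n then allB n p else false

/-- Some number below `n` satisfies `p`. -/
def anyB : ℕ → (ℕ → Bool) → Bool
  | 0, _ => false
  | n + 1, p => bif p n then true else anyB n p

/-- The graph on `Fin n` coded by `N`. -/
def cg (n N : ℕ) : SimpleGraph (Fin n) where
  Adj i j := i ≠ j ∧ tb N i j = true ∧ tb N j i = true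
  symm := ⟨fun _ _ h => ⟨h.1.symm, h.2.2, h.2.1⟩⟩
  loopless := ⟨fun _ h => h.1 rfl⟩

/-- The certificate `c` codes a map from the graph `N` on `n + 1` vertices to the graph `N'` on `n`
vertices which identifies only `u` and `v`. -/
def certOK (n N c u v N' : ℕ) : Bool :=
  allB (n + 1) fun i => bif Nat.blt (dg c i) n then
    allB (n + 1) fun j =>
      bif Nat.beq (dg c i) (dg c j) then
        (Nat.beq i j || (Nat.beq i u && Nat.beq j v) || (Nat.beq i v && Nat.beq j u))
      else bif tb N i j then tb N' (dg c i) (dg c j) else true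
    else false

/-- Every contraction of the graph `N` on `n + 1` vertices is a subgraph of a graph in `L`. -/
def nodeOK (n N : ℕ) (cs L : List ℕ) : Bool :=
  (allB (n + 1) fun v => anyB (n + 1) fun u => !(Nat.beq u v) && tb N u v && tb N v u) &&
  allB (n + 1) fun u => allB u fun v => bif tb N u v then
    cs.any fun c => Nat.beq (dg c u) (dg c v) &&
      (match L[Nat.shiftRight c (Nat.mul 4 (n + 1))]? with
        | none => false
        | some N' => certOK n N c u v N')
    else true

/-- All graphs of a level pass the check. -/
def levelOK (n : ℕ) (l : List (ℕ × List ℕ)) (L : List ℕ) : Bool :=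
  l.all fun p => nodeOK n p.1 p.2 L

/-- Cone over the graph `N` on `n` vertices. -/
def coneC (n N : ℕ) : ℕ :=
  n.rec N fun i A => Nat.lor A (Nat.lor (Nat.shiftLeft 1 (16 * i + n)) (Nat.shiftLeft 1 (16 * n + i)))

/-- The cone restricts to the base graph. -/
def coneOK (n N : ℕ) : Bool :=
  allB n fun i => allB n fun j => bif tb (coneC n N) i j then tb N i j else true

/-- Backtracking search for a subgraph. -/
def srch (n N : ℕ) : List (List ℕ) → List ℕ → ℕ → Bool
  | [], _, _ => true
  | b :: bs, m, av =>
    match b.foldl (fun a o => Nat.land a (Nat.shiftRight N (Nat.mul 16 (m.getD o 0)))) av with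
    | 0 => false
    | k + 1 => anyB n fun x =>
        bif tb (k + 1) 0 x then srch n N bs (x :: m) (Nat.xor av (Nat.shiftLeft 1 x)) else false

theorem allB_iff {n : ℕ} {p : ℕ → Bool} : allB n p = true ↔ ∀ i < n, p i = true := by
  induction n with
  | zero => simp [allB]
  | succ n ih =>
    unfold allB
    cases hp : p n
    · simp only [cond_false]
      exact ⟨fun h => by simp at h, fun h => by rw [← hp]; exact h n (Nat.lt_succ_self n)⟩
    · simp only [cond_true, ih]
      constructor
      · intro h i hi
        rcases Nat.lt_succ_iff_lt_or_eq.1 hi with h' | rfl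
        · exact h i h'
        · exact hp
      · exact fun h i hi => h i (Nat.lt_succ_of_lt hi)

theorem anyB_iff {n : ℕ} {p : ℕ → Bool} : anyB n p = true ↔ ∃ i < n, p i = true := by
  induction n with
  | zero => simp [anyB]
  | succ n ih =>
    unfold anyB
    cases hp : p n
    · simp only [cond_false, ih]
      constructor
      · rintro ⟨i, hi, h⟩
        exact ⟨i, Nat.lt_succ_of_lt hi, h⟩
      · rintro ⟨i, hi, h⟩
        rcases Nat.lt_succ_iff_lt_or_eq.1 hi with h' | rfl
        · exact ⟨i, h', h⟩
        · rw [hp] at h; simp at h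
    · simp only [cond_true]
      exact ⟨fun _ => ⟨n, Nat.lt_succ_self n, hp⟩, fun _ => trivial⟩

theorem nbeq {a b : ℕ} : Nat.beq a b = true ↔ a = b :=
  ⟨Nat.eq_of_beq_eq_true, fun h => by subst h; exact Nat.beq_refl a⟩

theorem nblt {a b : ℕ} : Nat.blt a b = true ↔ a < b := Nat.ble_eq.to_iff

theorem bif_imp {a b : Bool} : (bif a then b else true) = true ↔ (a = true → b = true) := by
  cases a <;> simp

theorem bif_and {a b : Bool} : (bif a then b else false) = true ↔ (a = true ∧ b = true) := by
  cases a <;> simp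

theorem certOK_spec {n N c u v N' : ℕ} (h : certOK n N c u v N' = true) :
    (∀ i < n + 1, dg c i < n) ∧
    (∀ i < n + 1, ∀ j < n + 1, dg c i = dg c j → i = j ∨ (i = u ∧ j = v) ∨ (i = v ∧ j = u)) ∧
    (∀ i < n + 1, ∀ j < n + 1, dg c i ≠ dg c j → tb N i j = true →
      tb N' (dg c i) (dg c j) = true) := by
  unfold certOK at h
  simp only [allB_iff, bif_and, nblt] at h
  refine ⟨fun i hi => (h i hi).1, fun i hi j hj he => ?_, fun i hi j hj he ht => ?_⟩
  · have := (h i hi).2 j hj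
    rw [nbeq.2 he] at this
    simpa [nbeq, or_assoc] using this
  · have := (h i hi).2 j hj
    have hb : Nat.beq (dg c i) (dg c j) = false := by
      rw [← Bool.not_eq_true, nbeq]; exact he
    rw [hb] at this
    simpa [ht] using this

theorem node_step {W : Type} [Fintype W] {H : SimpleGraph W} {n N : ℕ} {cs L : List ℕ}
    (h : nodeOK n N cs L = true) (hc : Fintype.card W < n + 1)
    (hL : ∀ N' ∈ L, ¬ IsMinor H (cg n N')) : ¬ IsMinor H (cg (n + 1) N) := by
  unfold nodeOK at h
  rw [Bool.and_eq_true] at h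
  obtain ⟨h1, h2⟩ := h
  simp only [allB_iff, anyB_iff, bif_imp, List.any_eq_true, Bool.and_eq_true, nbeq] at h1 h2
  have edge : ∀ u v : Fin (n + 1), v < u → (cg (n + 1) N).Adj u v →
      ∃ (V' : Type) (G' : SimpleGraph V') (r : Fin (n + 1) → V'),
      (∀ a b, r a = r b → a = b ∨ (a = u ∧ b = v) ∨ (a = v ∧ b = u)) ∧
      (∀ a b, (cg (n + 1) N).Adj a b → r a = r b ∨ G'.Adj (r a) (r b)) ∧ ¬ IsMinor H G' := by
    intro u v hvu huv
    obtain ⟨c, -, -, hc⟩ := h2 u u.2 v hvu huv.2.1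
    split at hc
    · simp at hc
    · rename_i N' hN'
      obtain ⟨k1, k2, k3⟩ := certOK_spec hc
      refine ⟨Fin n, cg n N', fun i => ⟨dg c i, k1 i i.2⟩, ?_, ?_, hL N' (List.mem_of_getElem? hN')⟩
      · intro a b hab
        simpa [Fin.ext_iff] using k2 a a.2 b b.2 (by simpa using hab)
      · intro a b hab
        by_cases he : dg c a = dg c b
        · left; simpa using he
        · right
          exact ⟨by simpa using he, k3 a a.2 b b.2 he hab.2.1,
            k3 b b.2 a a.2 (Ne.symm he) hab.2.2⟩
  refine minor_step (by simpa using hc) ?_ ?_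
  · intro v
    obtain ⟨u, hu, ⟨hne, ha⟩, hb⟩ := h1 v v.2
    refine ⟨⟨u, hu⟩, ?_, hb, ha⟩
    intro he
    rw [he] at hne
    simp at hne
  · intro u v huv
    rcases lt_or_gt_of_ne huv.1 with hlt | hlt
    · obtain ⟨V', G', r, k1, k2, k3⟩ := edge v u hlt huv.symm
      exact ⟨V', G', r, fun a b hab => (k1 a b hab).imp id Or.symm, k2, k3⟩
    · exact edge u v hlt huv

theorem level_step {W : Type} [Fintype W] {H : SimpleGraph W} {n : ℕ} {l : List (ℕ × List ℕ)}
    {L : List ℕ} (h : levelOK n l L = true) (hc : Fintype.card W < n + 1)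
    (hL : ∀ N' ∈ L, ¬ IsMinor H (cg n N')) : ∀ N ∈ l.map Prod.fst, ¬ IsMinor H (cg (n + 1) N) := by
  intro N hN
  obtain ⟨p, hp, rfl⟩ := List.mem_map.1 hN
  unfold levelOK at h
  exact node_step (List.all_eq_true.1 h p hp) hc hL

/-- A list of images which is a solution of the search problem. -/
def Sol (n N : ℕ) : List (List ℕ) → List ℕ → ℕ → List ℕ → Prop
  | [], _, _, _ => True
  | _ :: _, _, _, [] => False
  | b :: bs, m, av, x :: xs => x < n ∧ tb av 0 x = true ∧ (∀ o ∈ b, tb N (m.getD o 0) x = true) ∧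
      Sol n N bs (x :: m) (Nat.xor av (Nat.shiftLeft 1 x)) xs

theorem tb_iff {N i j : ℕ} : tb N i j = true ↔ N.testBit (16 * i + j) = true := by
  unfold tb
  rw [nbeq, Nat.testBit_eq_decide_div_mod_eq]
  change ((N >>> (16 * i + j)) &&& 1 = 1) ↔ _
  rw [Nat.and_one_is_mod, Nat.shiftRight_eq_div_pow]
  simp

theorem tb_fold (N x : ℕ) (m b : List ℕ) (av : ℕ) (h0 : tb av 0 x = true)
    (h : ∀ o ∈ b, tb N (m.getD o 0) x = true) :
    tb (b.foldl (fun a o => Nat.land a (Nat.shiftRight N (Nat.mul 16 (m.getD o 0)))) av) 0 x = true := by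
  induction b generalizing av with
  | nil => exact h0
  | cons o b ih =>
    rw [List.foldl_cons]
    refine ih _ ?_ fun o' ho' => h o' (List.mem_cons_of_mem _ ho')
    have h1 := h o List.mem_cons_self
    rw [tb_iff] at h0 h1 ⊢
    change (av &&& (N >>> (16 * (m.getD o 0)))).testBit _ = true
    rw [Nat.testBit_land, Nat.testBit_shiftRight]
    simp at h0 h1 ⊢
    exact ⟨h0, h1⟩

theorem srch_complete (n N : ℕ) (bs : List (List ℕ)) (m : List ℕ) (av : ℕ) (xs : List ℕ)
    (h : Sol n N bs m av xs) : srch n N bs m av = true := by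
  induction bs generalizing m av xs with
  | nil => rfl
  | cons b bs ih =>
    cases xs with
    | nil => exact h.elim
    | cons x xs =>
      obtain ⟨h1, h2, h3, h4⟩ := h
      have hf := tb_fold N x m b av h2 h3
      unfold srch
      split
      · rename_i heq
        rw [heq] at hf
        rw [tb_iff] at hf
        simp at hf
      · rename_i k heq
        rw [heq] at hf
        rw [anyB_iff]
        refine ⟨x, h1, ?_⟩
        rw [bif_and]
        exact ⟨hf, ih _ _ _ h4⟩

theorem tb_remove {av x y : ℕ} (h : tb av 0 y = true) (hne : x ≠ y) :
    tb (Nat.xor av (Nat.shiftLeft 1 x)) 0 y = true := by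
  rw [tb_iff] at h ⊢
  change (av ^^^ (1 <<< x)).testBit _ = true
  rw [Nat.testBit_xor, h, Nat.one_shiftLeft, Nat.testBit_two_pow]
  simp [hne]

instance cgDec (n N : ℕ) : DecidableRel (cg n N).Adj := fun i j =>
  inferInstanceAs (Decidable (i ≠ j ∧ tb N i j = true ∧ tb N j i = true))

/-- Orders of the graphs in the Petersen family. -/
def pn (i : ℕ) : ℕ := petn.getD i 0

/-- Codes of the graphs in the Petersen family. -/
def pN (i : ℕ) : ℕ := petN.getD i 0

/-- The graphs in the Petersen family. -/
def pet (i : ℕ) : SimpleGraph (Fin (pn i)) := cg (pn i) (pN i)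

/-- The code of `K₅`. -/
def cK5 : ℕ := 276707635146073636894

/-- The code of `K₃₃`. -/
def cK33 : ℕ := 8462609866481485548617784

/-- The vertices `x` and `y` are adjacent. -/
def adj2 (N x y : ℕ) : Bool := !(Nat.beq x y) && tb N x y && tb N y x

/-- The list is an elimination order of a connected set. -/
def connL (N : ℕ) : List ℕ → Bool
  | [] => false
  | x :: l => l.isEmpty || (l.any (adj2 N x) && connL N l)

/-- The lists in `B` are the branch sets of a model of the graph `NH` in the graph `N`. -/
def mOK (n N NH : ℕ) (B : List (List ℕ)) : Bool :=
  (B.all fun l => connL N l && l.all fun x => Nat.blt x n) &&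
  allB B.length fun a => allB B.length fun b =>
    (Nat.beq a b || (B.getD a []).all fun x => !((B.getD b []).any fun y => Nat.beq x y)) &&
    (!(tb NH a b) || (B.getD a []).any fun x => (B.getD b []).any fun y => adj2 N x y)

theorem adj2_iff {n N : ℕ} {x y : Fin n} : adj2 N x y = true ↔ (cg n N).Adj x y := by
  unfold adj2
  simp only [Bool.and_eq_true, Bool.not_eq_true', ← Bool.not_eq_true, nbeq, cg, ne_eq, Fin.ext_iff,
    and_assoc]

theorem connL_spec {n N : ℕ} (l : List ℕ) (h : connL N l = true) (hl : ∀ x ∈ l, x < n) :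
    ((cg n N).induce {v : Fin n | v.val ∈ l}).Connected := by
  have key : ∃ s ∈ l, ∀ P : ℕ → Prop, P s →
      (∀ a ∈ l, ∀ b ∈ l, adj2 N a b = true → P a → P b) → ∀ b ∈ l, P b := by
    clear hl
    induction l with
    | nil => simp [connL] at h
    | cons x l ih =>
      unfold connL at h
      rw [Bool.or_eq_true] at h
      rcases h with h | h
      · rw [List.isEmpty_iff] at h
        subst h
        refine ⟨x, by simp, ?_⟩
        intro P hP _ b hb
        simp at hb
        rw [hb]; exact hP
      · rw [Bool.and_eq_true] at h
        obtain ⟨s, hs, hind⟩ := ih h.2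
        refine ⟨s, List.mem_cons_of_mem _ hs, ?_⟩
        intro P hP hstep
        have hl := hind P hP fun a ha b hb =>
          hstep a (List.mem_cons_of_mem _ ha) b (List.mem_cons_of_mem _ hb)
        obtain ⟨y, hy, hxy⟩ := List.any_eq_true.1 h.1
        have hyx : adj2 N y x = true := by
          unfold adj2 at hxy ⊢
          simp only [Bool.and_eq_true, Bool.not_eq_true', ← Bool.not_eq_true, nbeq] at hxy ⊢
          exact ⟨⟨Ne.symm hxy.1.1, hxy.2⟩, hxy.1.2⟩
        intro b hb
        rcases List.mem_cons.1 hb with rfl | hb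
        · exact hstep y (List.mem_cons_of_mem _ hy) b List.mem_cons_self hyx (hl y hy)
        · exact hl b hb
  obtain ⟨s, hs, hind⟩ := key
  refine conn_of_ind ⟨s, hl s hs⟩ hs ?_
  intro P hP hstep b hb
  have := hind (fun x => ∃ hx : x < n, P ⟨x, hx⟩) ⟨hl s hs, hP⟩ (by
    rintro a ha c hc hac ⟨hx, hPa⟩
    exact ⟨hl c hc, hstep ⟨a, hx⟩ ha ⟨c, hl c hc⟩ hc (adj2_iff.1 hac) hPa⟩) b.val hb
  exact this.2

theorem mOK_spec {n N NH : ℕ} {B : List (List ℕ)} (h : mOK n N NH B = true) :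
    Model (cg B.length NH) (cg n N) (fun w => {v : Fin n | v.val ∈ B.getD w []}) := by
  unfold mOK at h
  simp only [Bool.and_eq_true, List.all_eq_true, allB_iff, nblt] at h
  obtain ⟨h1, h2⟩ := h
  have hm : ∀ w : Fin B.length, B.getD w [] ∈ B := by
    intro w
    rw [List.getD_eq_getElem _ _ w.2]
    exact List.getElem_mem _
  have hcon : ∀ w : Fin B.length, ((cg n N).induce {v : Fin n | v.val ∈ B.getD w []}).Connected :=
    fun w => connL_spec _ (h1 _ (hm w)).1 (h1 _ (hm w)).2
  refine ⟨?_, hcon, ?_, ?_⟩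
  · intro w
    obtain ⟨⟨s, hs⟩⟩ := (hcon w).nonempty
    exact ⟨s, hs⟩
  · intro a b hab
    rw [Set.disjoint_left]
    intro v hv hv'
    have := (h2 a a.2 b b.2).1
    rw [Bool.or_eq_true, nbeq] at this
    rcases this with h | h
    · exact hab (Fin.ext h)
    · rw [List.all_eq_true] at h
      have := h _ hv
      simp only [Bool.not_eq_true', ← Bool.not_eq_true, List.any_eq_true, nbeq] at this
      exact this ⟨_, hv', rfl⟩
  · intro a b hab
    have := (h2 a a.2 b b.2).2
    rw [hab.2.1] at this
    simp only [Bool.not_true, Bool.false_or, List.any_eq_true] at this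
    obtain ⟨x, hx, y, hy, hxy⟩ := this
    exact ⟨⟨x, (h1 _ (hm a)).2 x hx⟩, hx, ⟨y, (h1 _ (hm b)).2 y hy⟩, hy, adj2_iff.1 hxy⟩

/-- Deleting any vertex of a graph of the Petersen family leaves a nonplanar graph. -/
def kOK : Bool :=
  allB 7 fun i => allB (pn i) fun w =>
    match (kCerts.getD i []).getD w (true, []) with
    | (t, B) => Nat.beq B.length (bif t then 5 else 6) &&
        mOK (pn i) (pN i) (bif t then cK5 else cK33) B &&
        B.all fun l => l.all fun x => !(Nat.beq x w)

theorem kOK_true : kOK = true := by decide +kernel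

theorem pet_nonapex (i : ℕ) (hi : i < 7) (w : Fin (pn i)) :
    (∃ f, Model (cg 5 cK5) (pet i) f ∧ ∀ x, w ∉ f x) ∨
    (∃ f, Model (cg 6 cK33) (pet i) f ∧ ∀ x, w ∉ f x) := by
  have h := kOK_true
  unfold kOK at h
  simp only [allB_iff] at h
  have h := h i hi w w.2
  generalize (kCerts.getD i []).getD w (true, []) = tB at h
  obtain ⟨t, B⟩ := tB
  simp only [Bool.and_eq_true, nbeq, List.all_eq_true, Bool.not_eq_true', ← Bool.not_eq_true] at h
  obtain ⟨⟨h1, h2⟩, h3⟩ := h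
  have h2 := mOK_spec h2
  have hav : ∀ x : ℕ, w.val ∉ B.getD x [] := by
    intro x hx
    rw [List.getD_eq_getElem?_getD] at hx
    cases hb : B[x]? with
    | none => rw [hb] at hx; simp at hx
    | some l =>
      rw [hb] at hx
      exact h3 l (List.mem_of_getElem? hb) _ hx rfl
  cases t
  · right
    simp only [cond_false] at h1 h2
    rw [h1] at h2
    exact ⟨_, h2, fun x => hav x⟩
  · left
    simp only [cond_true] at h1 h2
    rw [h1] at h2
    exact ⟨_, h2, fun x => hav x⟩

/-! ### The graph `C₁₃(1,3)` is linkless -/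

theorem okT6 : levelOK 5 lvT6 (lvT5.map Prod.fst) = true := by decide +kernel
theorem okT7 : levelOK 6 lvT7 (lvT6.map Prod.fst) = true := by decide +kernel
theorem okT8 : levelOK 7 lvT8 (lvT7.map Prod.fst) = true := by decide +kernel
theorem okT9 : levelOK 8 lvT9 (lvT8.map Prod.fst) = true := by decide +kernel
theorem okT10 : levelOK 9 lvT10 (lvT9.map Prod.fst) = true := by decide +kernel
theorem okN9 : levelOK 8 lvN9 (lvT7.map fun p => coneC 7 p.1) = true := by decide +kernel
theorem okN10 : levelOK 9 lvN10 (lvN9.map Prod.fst ++ lvT8.map fun p => coneC 8 p.1) = true := by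
  decide +kernel
theorem okN11 : levelOK 10 lvN11 (lvN10.map Prod.fst ++ lvT9.map fun p => coneC 9 p.1) = true := by
  decide +kernel
theorem okN12 : levelOK 11 lvN12 (lvN11.map Prod.fst ++ lvT10.map fun p => coneC 10 p.1) = true := by
  decide +kernel
theorem okN13 : levelOK 12 lvN13 (lvN12.map Prod.fst) = true := by decide +kernel
theorem okCone : (lvT7.all fun p => coneOK 7 p.1) = true ∧ (lvT8.all fun p => coneOK 8 p.1) = true ∧
    (lvT9.all fun p => coneOK 9 p.1) = true ∧ (lvT10.all fun p => coneOK 10 p.1) = true := by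
  decide +kernel

theorem okK5 : (lvT5.all fun p =>
    !(srch 5 p.1 [[], [0], [0, 1], [0, 1, 2], [0, 1, 2, 3]] [] 31)) = true := by decide +kernel
theorem okK33 : (lvT6.all fun p =>
    !(srch 6 p.1 [[], [], [], [0, 1, 2], [1, 2, 3], [2, 3, 4]] [] 63)) = true := by decide +kernel
theorem okP9 : (lvN9.all fun p =>
    !(srch 9 p.1 [[], [0], [0, 1], [2], [0, 2], [1, 2], [1, 3], [1, 5], [0, 1, 7]] [] 511)) = true := by
  decide +kernel
theorem okP10 : (lvN10.all fun p => !(srch 10 p.1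
    [[0], [1], [0], [0, 2], [3], [0, 2], [0, 6], [2, 5], [0, 1, 4]] [0] 1022)) = true := by
  decide +kernel

/-- The certificate codes an automorphism of the Petersen graph which moves `0` to `v`. -/
def autOK : Bool := allB 10 fun v =>
  Nat.beq (dg (pAut.getD v 0) 0) v &&
  allB 10 fun i => Nat.blt (dg (pAut.getD v 0) i) 10 && allB 10 fun j =>
    (Nat.beq i j || !(Nat.beq (dg (pAut.getD v 0) i) (dg (pAut.getD v 0) j))) &&
    (!(tb (pN 6) i j) || tb (pN 6) (dg (pAut.getD v 0) i) (dg (pAut.getD v 0) j))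

theorem autOK_true : autOK = true := by decide +kernel
/-- The search plan only uses edges of the graph `NH`. -/
def planOK (NH : ℕ) : ℕ → List (List ℕ) → Bool
  | _, [] => true
  | k, b :: bs => (b.all fun o => Nat.blt o k && tb NH (k - 1 - o) k) && planOK NH (k + 1) bs

theorem sol_exists {n N NH : ℕ} (h : ℕ → ℕ) (bs : List (List ℕ)) (k t : ℕ) (m : List ℕ) (av : ℕ)
    (ht : k + bs.length = t) (hp : planOK NH k bs = true)
    (hn : ∀ i < t, h i < n) (hi : ∀ i < t, ∀ j < t, h i = h j → i = j)
    (ha : ∀ i < t, ∀ j < t, tb NH i j = true → tb N (h i) (h j) = true)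
    (hav : ∀ i < t, k ≤ i → tb av 0 (h i) = true)
    (hm : ∀ o < k, m.getD o 0 = h (k - 1 - o)) : ∃ xs, Sol n N bs m av xs := by
  induction bs generalizing k m av with
  | nil => exact ⟨[], trivial⟩
  | cons b bs ih =>
    unfold planOK at hp
    simp only [Bool.and_eq_true, List.all_eq_true, nblt] at hp
    simp only [List.length_cons] at ht
    have hk : k < t := by omega
    obtain ⟨xs, hxs⟩ := ih (k + 1) (h k :: m) (Nat.xor av (Nat.shiftLeft 1 (h k))) (by omega) hp.2
      (fun i hit hki => tb_remove (hav i hit (by omega)) fun he => by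
        have := hi k hk i hit he; omega)
      (fun o ho => by
        cases o with
        | zero => simp
        | succ o =>
          rw [List.getD_cons_succ, hm o (by omega)]
          congr 1; omega)
    refine ⟨h k :: xs, hn k hk, hav k hk le_rfl, ?_, hxs⟩
    intro o ho
    have := hp.1 o ho
    rw [hm o this.1]
    exact ha _ (by omega) _ hk this.2

theorem srch_of_hom {n N NH : ℕ} (h : Fin n → Fin n) (hi : Function.Injective h)
    (ha : ∀ a b, (cg n NH).Adj a b → (cg n N).Adj (h a) (h b))
    (hs : ∀ i < n, ∀ j < n, tb NH i j = true → i ≠ j ∧ tb NH j i = true)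
    (bs : List (List ℕ)) (k : ℕ) (m : List ℕ) (av : ℕ)
    (ht : k + bs.length = n) (hp : planOK NH k bs = true)
    (hav : ∀ i : Fin n, k ≤ i → tb av 0 (h i) = true)
    (hm : ∀ o : Fin n, ∀ ho : o < k, m.getD o 0 = h ⟨k - 1 - o, by omega⟩) :
    srch n N bs m av = true := by
  obtain ⟨xs, hxs⟩ := sol_exists (n := n) (N := N) (fun i => if hx : i < n then h ⟨i, hx⟩ else 0)
    bs k n m av ht hp (fun i hi => by simp [hi])
    (fun i h1 j h2 he => by
      simp only [h1, h2, dif_pos] at he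
      simpa using hi (Fin.ext he))
    (fun i h1 j h2 he => by
      simp only [h1, h2, dif_pos]
      obtain ⟨k1, k2⟩ := hs i h1 j h2 he
      exact (ha ⟨i, h1⟩ ⟨j, h2⟩ ⟨by simpa using k1, he, k2⟩).2.1)
    (fun i h1 h2 => by
      simp only [h1, dif_pos]
      exact hav ⟨i, h1⟩ h2)
    (fun o ho => by
      have h1 : k - 1 - o < n := by omega
      simp only [h1, dif_pos]
      exact hm ⟨o, by omega⟩ ho)
  exact srch_complete n N bs m av xs hxs

/-- The code is a simple graph. -/
def simpOK (n NH : ℕ) : Bool := allB n fun i => allB n fun j =>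
  !(tb NH i j) || (!(Nat.beq i j) && tb NH j i)

theorem simpOK_spec {n NH : ℕ} (h : simpOK n NH = true) :
    ∀ i < n, ∀ j < n, tb NH i j = true → i ≠ j ∧ tb NH j i = true := by
  intro i hi j hj ht
  unfold simpOK at h
  simp only [allB_iff] at h
  have := h i hi j hj
  rw [ht] at this
  simpa [nbeq, ← Bool.not_eq_true] using this

theorem not_minor_of_srch {n N NH : ℕ} {bs : List (List ℕ)} {av : ℕ} (h : srch n N bs [] av = false)
    (hl : bs.length = n) (hp : planOK NH 0 bs = true) (hs : simpOK n NH = true)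
    (hav : ∀ i < n, tb av 0 i = true) : ¬ IsMinor (cg n NH) (cg n N) := by
  intro hm
  obtain ⟨g, hg, ha⟩ := minor_spanning hm rfl
  rw [srch_of_hom g hg ha (simpOK_spec hs) bs 0 [] av (by omega) hp
    (fun i _ => hav _ (g i).2) (fun o ho => by omega)] at h
  simp at h

/-- No `K₅` and no `K₃₃` minor. -/
def Pl (n N : ℕ) : Prop := ¬ IsMinor (cg 5 cK5) (cg n N) ∧ ¬ IsMinor (cg 6 cK33) (cg n N)

theorem plT5 : ∀ N ∈ lvT5.map Prod.fst, Pl 5 N := by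
  intro N hN
  obtain ⟨p, hp, rfl⟩ := List.mem_map.1 hN
  constructor
  · have := List.all_eq_true.1 okK5 p hp
    exact not_minor_of_srch (by simpa using this) rfl (by decide +kernel) (by decide +kernel)
      (by decide +kernel)
  · intro h
    simpa using minor_card h

theorem plT6 : ∀ N ∈ lvT6.map Prod.fst, Pl 6 N := by
  intro N hN
  refine ⟨level_step okT6 (by simp) (fun N' h => (plT5 N' h).1) N hN, ?_⟩
  obtain ⟨p, hp, rfl⟩ := List.mem_map.1 hN
  have := List.all_eq_true.1 okK33 p hp
  exact not_minor_of_srch (by simpa using this) rfl (by decide +kernel) (by decide +kernel)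
      (by decide +kernel)

theorem pl_step {n : ℕ} {l l' : List (ℕ × List ℕ)} (hl : levelOK n l (l'.map Prod.fst) = true)
    (hn : 6 < n + 1) (h : ∀ N ∈ l'.map Prod.fst, Pl n N) : ∀ N ∈ l.map Prod.fst, Pl (n + 1) N :=
  fun N hN => ⟨level_step hl (by simp; omega) (fun N' h' => (h N' h').1) N hN,
    level_step hl (by simpa using hn) (fun N' h' => (h N' h').2) N hN⟩

theorem plT7 : ∀ N ∈ lvT7.map Prod.fst, Pl 7 N := pl_step okT7 (by norm_num) plT6
theorem plT8 : ∀ N ∈ lvT8.map Prod.fst, Pl 8 N := pl_step okT8 (by norm_num) plT7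
theorem plT9 : ∀ N ∈ lvT9.map Prod.fst, Pl 9 N := pl_step okT9 (by norm_num) plT8
theorem plT10 : ∀ N ∈ lvT10.map Prod.fst, Pl 10 N := pl_step okT10 (by norm_num) plT9

theorem pull_base {W : Type} {H : SimpleGraph W} {n N : ℕ} (hn : 0 < n) (hc : coneOK n N = true)
    {f : W → Set (Fin (n + 1))} (hf : Model H (cg (n + 1) (coneC n N)) f)
    (ha : ∀ w, Fin.last n ∉ f w) : IsMinor H (cg n N) := by
  unfold coneOK at hc
  simp only [allB_iff, bif_imp] at hc
  obtain ⟨f1, f2, f3, f4⟩ := hf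
  let r : Fin (n + 1) → Fin n := fun x => if hx : x.val < n then ⟨x, hx⟩ else ⟨0, hn⟩
  have hlt : ∀ w, ∀ x ∈ f w, x.val < n := by
    intro w x hx
    have h1 := x.2
    by_contra hcon
    have : x = Fin.last n := Fin.ext (by simp; omega)
    exact ha w (this ▸ hx)
  have hadj : ∀ w w', ∀ a ∈ f w, ∀ b ∈ f w', (cg (n + 1) (coneC n N)).Adj a b →
      (cg n N).Adj (r a) (r b) := by
    intro w w' a h1 b h2 hab
    have k1 := hlt _ _ h1
    have k2 := hlt _ _ h2
    simp only [r, k1, k2, dif_pos]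
    refine ⟨?_, hc _ k1 _ k2 hab.2.1, hc _ k2 _ k1 hab.2.2⟩
    intro he
    exact hab.1 (Fin.ext (by simpa using he))
  refine ⟨fun w => r '' f w, fun w => (f1 w).image r,
    fun w => conn_image (f2 w) r fun a h1 b h2 hab => Or.inr (hadj w w a h1 b h2 hab), ?_, ?_⟩
  · intro w w' hw
    rw [Set.disjoint_left]
    rintro _ ⟨a, h1, rfl⟩ ⟨b, h2, hab⟩
    have k1 := hlt _ _ h1
    have k2 := hlt _ _ h2
    simp only [r, k1, k2, dif_pos] at hab
    have : b = a := Fin.ext (by simpa using hab)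
    exact Set.disjoint_left.1 (f3 hw) h1 (this ▸ h2)
  · intro w w' hw
    obtain ⟨a, h1, b, h2, hab⟩ := f4 hw
    exact ⟨_, ⟨a, h1, rfl⟩, _, ⟨b, h2, rfl⟩, hadj w w' a h1 b h2 hab⟩

theorem pn_pos {i : ℕ} (hi : i < 7) : 0 < pn i := by
  have : allB 7 (fun i => Nat.blt 0 (pn i)) = true := by decide +kernel
  rw [allB_iff] at this
  exact nblt.1 (this i hi)

theorem apex {n N : ℕ} (hn : 0 < n) (hc : coneOK n N = true) (hp : Pl n N) {i : ℕ} (hi : i < 7) :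
    ¬ IsMinor (pet i) (cg (n + 1) (coneC n N)) := by
  rintro ⟨f, hf⟩
  have hf : Model (pet i) (cg (n + 1) (coneC n N)) f := hf
  have : ∃ w, ∀ w', Fin.last n ∈ f w' → w' = w := by
    by_cases h : ∃ w, Fin.last n ∈ f w
    · obtain ⟨w, hw⟩ := h
      refine ⟨w, fun w' hw' => ?_⟩
      by_contra hne
      exact Set.disjoint_left.1 (hf.2.2.1 hne) hw' hw
    · push Not at h
      exact ⟨⟨0, pn_pos hi⟩, fun w' hw' => absurd hw' (h w')⟩
  obtain ⟨w, hw⟩ := this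
  rcases pet_nonapex i hi w with ⟨g, hg, hgw⟩ | ⟨g, hg, hgw⟩
  · refine hp.1 (pull_base hn hc (hg.trans hf) ?_)
    intro x hx
    obtain ⟨b, hb, h1⟩ := Set.mem_iUnion₂.1 hx
    exact hgw x (hw b h1 ▸ hb)
  · refine hp.2 (pull_base hn hc (hg.trans hf) ?_)
    intro x hx
    obtain ⟨b, hb, h1⟩ := Set.mem_iUnion₂.1 hx
    exact hgw x (hw b h1 ▸ hb)

theorem apex_list {n : ℕ} {l : List (ℕ × List ℕ)} (hn : 0 < n)
    (hc : (l.all fun p => coneOK n p.1) = true) (hp : ∀ N ∈ l.map Prod.fst, Pl n N) {i : ℕ}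
    (hi : i < 7) : ∀ N ∈ l.map (fun p => coneC n p.1), ¬ IsMinor (pet i) (cg (n + 1) N) := by
  intro N hN
  obtain ⟨p, h, rfl⟩ := List.mem_map.1 hN
  exact apex hn (List.all_eq_true.1 hc p h) (hp _ (List.mem_map.2 ⟨p, h, rfl⟩)) hi

theorem pn_vals {i : ℕ} (hi : i < 7) : pn i < 9 ∨ i = 4 ∨ i = 6 := by
  interval_cases i <;> decide

theorem noN9 {i : ℕ} (hi : i < 7) : ∀ N ∈ lvN9.map Prod.fst, ¬ IsMinor (pet i) (cg 9 N) := by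
  intro N hN
  rcases pn_vals hi with h | rfl | rfl
  · exact level_step okN9 (by simpa using h) (apex_list (by norm_num) okCone.1 plT7 hi) N hN
  · obtain ⟨p, hp, rfl⟩ := List.mem_map.1 hN
    have := List.all_eq_true.1 okP9 p hp
    exact not_minor_of_srch (n := 9) (NH := pN 4) (by simpa using this) rfl (by decide +kernel) (by decide +kernel)
      (by decide +kernel)
  · intro h
    have := minor_card h
    simp [pn, petn] at this

theorem noP10 : ∀ N ∈ lvN10.map Prod.fst, ¬ IsMinor (pet 6) (cg 10 N) := by
  intro N hN hm
  obtain ⟨p, hp, rfl⟩ := List.mem_map.1 hN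
  have hsr := List.all_eq_true.1 okP10 p hp
  obtain ⟨g, hg, ha⟩ := minor_spanning hm rfl
  change Fin 10 → Fin 10 at g
  have ha' : ∀ a b : Fin 10, (cg 10 (pN 6)).Adj a b → (cg 10 p.1).Adj (g a) (g b) := ha
  have hg' : Function.Injective g := hg
  obtain ⟨v, hv⟩ := (Finite.injective_iff_surjective.1 hg') 0
  have hau := autOK_true
  unfold autOK at hau
  simp only [allB_iff, Bool.and_eq_true, nbeq, nblt] at hau
  obtain ⟨h1, h2⟩ := hau v v.2
  let s : Fin 10 → Fin 10 := fun i => ⟨dg (pAut.getD v 0) i, (h2 i i.2).1⟩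
  have hs0 : s 0 = v := Fin.ext h1
  have hsi : Function.Injective s := by
    intro a b hab
    have := ((h2 a a.2).2 b b.2).1
    rw [Bool.or_eq_true, nbeq] at this
    rcases this with h | h
    · exact Fin.ext h
    · exfalso
      rw [nbeq.2 (Fin.ext_iff.1 hab)] at h
      simp at h
  have hsa : ∀ a b : Fin 10, tb (pN 6) a b = true → tb (pN 6) (s a) (s b) = true := by
    intro a b hab
    have := ((h2 a a.2).2 b b.2).2
    rw [hab, Bool.not_true, Bool.false_or] at this
    exact this
  have hinj : Function.Injective (g ∘ s) := hg'.comp hsi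
  have h0 : (g ∘ s) 0 = 0 := by simp [hs0, hv]
  have hav : ∀ x : Fin 10, x ≠ 0 → tb 1022 0 x = true := by decide +kernel
  rw [srch_of_hom (N := p.1) (NH := pN 6) (g ∘ s) hinj
    (fun a b hab => ha' _ _ ⟨hsi.ne hab.1, hsa a b hab.2.1, hsa b a hab.2.2⟩)
    (simpOK_spec (by decide +kernel)) _ 1 [0] 1022 rfl (by decide +kernel) ?_ ?_] at hsr
  · simp at hsr
  · intro i hi
    refine hav _ fun h => ?_
    have := hinj (h.trans h0.symm)
    subst this
    simp at hi
  · intro o ho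
    have : o = 0 := Fin.ext (by simp; omega)
    subst this
    exact (Fin.ext_iff.1 h0).symm

theorem pn_vals' {i : ℕ} (hi : i < 7) : pn i < 10 ∨ i = 6 := by
  interval_cases i <;> decide

theorem pn_le {i : ℕ} (hi : i < 7) : pn i ≤ 10 := by
  interval_cases i <;> decide

theorem no_append {i n : ℕ} {l l' : List ℕ} (h : ∀ N ∈ l, ¬ IsMinor (pet i) (cg n N))
    (h' : ∀ N ∈ l', ¬ IsMinor (pet i) (cg n N)) : ∀ N ∈ l ++ l', ¬ IsMinor (pet i) (cg n N) :=
  fun N hN => (List.mem_append.1 hN).elim (h N) (h' N)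

theorem noN10 {i : ℕ} (hi : i < 7) : ∀ N ∈ lvN10.map Prod.fst, ¬ IsMinor (pet i) (cg 10 N) := by
  rcases pn_vals' hi with h | rfl
  · exact level_step okN10 (by simpa using h)
      (no_append (noN9 hi) (apex_list (by norm_num) okCone.2.1 plT8 hi))
  · exact noP10

theorem Q_no_pet {i : ℕ} (hi : i < 7) : ¬ IsMinor (pet i) (cg 13 qN) := by
  have hp := pn_le hi
  have h11 := level_step (H := pet i) okN11 (by simp; omega)
    (no_append (noN10 hi) (apex_list (by norm_num) okCone.2.2.1 plT9 hi))
  have h12 := level_step (H := pet i) okN12 (by simp; omega)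
    (no_append h11 (apex_list (by norm_num) okCone.2.2.2 plT10 hi))
  have h13 := level_step (H := pet i) okN13 (by simp; omega) h12
  refine h13 qN ?_
  have : lvN13.map Prod.fst = [qN] := by decide +kernel
  rw [this]
  exact List.mem_singleton.2 rfl

/-! ### The Petersen family consists of the seven graphs `pet i` -/

theorem triY_ns {V : Type} {G : SimpleGraph V} {a b c x : V} :
    (triangleY G a b c).Adj none (some x) ↔ (x = a ∨ x = b ∨ x = c) := by
  simp [triangleY, SimpleGraph.map_adj']

theorem triY_nn {V : Type} {G : SimpleGraph V} {a b c : V} :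
    ¬ (triangleY G a b c).Adj none none := fun h => h.ne rfl

theorem triY_ss {V : Type} {G : SimpleGraph V} {a b c x y : V} :
    (triangleY G a b c).Adj (some x) (some y) ↔
      G.Adj x y ∧ ¬ ((x = a ∨ x = b ∨ x = c) ∧ (y = a ∨ y = b ∨ y = c)) := by
  have h1 : (triangleY G a b c).Adj (some x) (some y) ↔
      G.Adj x y ∧ ¬ (s(x, y) = s(a, b) ∨ s(x, y) = s(b, c) ∨ s(x, y) = s(a, c)) := by
    simp only [triangleY, SimpleGraph.sup_adj, SimpleGraph.map_adj']
    simp only [SimpleGraph.deleteEdges_adj, Function.Embedding.some_apply, Option.some.injEq,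
      SimpleGraph.fromEdgeSet_adj, Set.mem_insert_iff, Set.mem_singleton_iff, Sym2.eq_iff,
      reduceCtorEq, false_and, and_false, or_false]
    constructor
    · rintro ⟨_, x, y, h, rfl, rfl⟩
      exact h
    · intro h
      exact ⟨by simpa using h.1.ne, x, y, h, rfl, rfl⟩
  rw [h1]
  constructor
  · rintro ⟨h, h2⟩
    have := h.ne
    refine ⟨h, fun h3 => h2 ?_⟩
    simp only [Sym2.eq_iff]
    grind
  · rintro ⟨h, h2⟩
    refine ⟨h, fun h3 => h2 ?_⟩
    simp only [Sym2.eq_iff] at h3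
    grind

/-- Isomorphic graphs have isomorphic `∇Y` moves. -/
theorem triY_congr {V V' : Type} {G : SimpleGraph V} {G' : SimpleGraph V'} (φ : G ≃g G')
    {a b c : V} {a' b' c' : V'}
    (h : ∀ x, (x = a ∨ x = b ∨ x = c) ↔ (φ x = a' ∨ φ x = b' ∨ φ x = c')) :
    Nonempty (triangleY G a b c ≃g triangleY G' a' b' c') := by
  refine ⟨⟨Equiv.optionCongr φ.toEquiv, ?_⟩⟩
  intro x y
  cases x with
  | none =>
    cases y with
    | none => simp
    | some y =>
      change (triangleY G' a' b' c').Adj none (some (φ y)) ↔ _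
      rw [triY_ns, triY_ns, h]
  | some x =>
    cases y with
    | none =>
      rw [SimpleGraph.adj_comm, SimpleGraph.adj_comm (triangleY G a b c)]
      change (triangleY G' a' b' c').Adj none (some (φ x)) ↔ _
      rw [triY_ns, triY_ns, h]
    | some y =>
      change (triangleY G' a' b' c').Adj (some (φ x)) (some (φ y)) ↔ _
      rw [triY_ss, triY_ss, h, h, φ.map_rel_iff]

theorem triY_recover {V : Type} {G : SimpleGraph V} {a b c x y : V} (hab : G.Adj a b)
    (hbc : G.Adj b c) (hac : G.Adj a c) : G.Adj x y ↔
      (triangleY G a b c).Adj (some x) (some y) ∨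
      (x ≠ y ∧ (triangleY G a b c).Adj none (some x) ∧ (triangleY G a b c).Adj none (some y)) := by
  rw [triY_ss, triY_ns, triY_ns]
  have h1 := hab.symm
  have h2 := hbc.symm
  have h3 := hac.symm
  constructor
  · intro h
    by_cases hx : (x = a ∨ x = b ∨ x = c) ∧ (y = a ∨ y = b ∨ y = c)
    · exact Or.inr ⟨h.ne, hx⟩
    · exact Or.inl ⟨h, hx⟩
  · rintro (h | ⟨hne, hx, hy⟩)
    · exact h.1
    · rcases hx with rfl | rfl | rfl <;> rcases hy with rfl | rfl | rfl <;>
        first | exact absurd rfl hne | assumption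

theorem triY_inv {V V' : Type} {G : SimpleGraph V} {G' : SimpleGraph V'} {a b c : V} {a' b' c' : V'}
    (hab : G.Adj a b) (hbc : G.Adj b c) (hac : G.Adj a c)
    (hab' : G'.Adj a' b') (hbc' : G'.Adj b' c') (hac' : G'.Adj a' c')
    (χ : triangleY G a b c ≃g triangleY G' a' b' c') (hχ : χ none = none) :
    Nonempty (G ≃g G') := by
  have hs : ∀ x, some (Equiv.removeNone χ.toEquiv x) = χ (some x) := by
    intro x
    refine Equiv.removeNone_some χ.toEquiv ?_
    rw [← Option.ne_none_iff_exists']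
    intro hx
    have hx : χ (some x) = none := hx
    rw [← hχ] at hx
    simpa using χ.injective hx
  refine ⟨⟨Equiv.removeNone χ.toEquiv, ?_⟩⟩
  intro x y
  rw [triY_recover hab hbc hac, triY_recover hab' hbc' hac', hs, hs, ← hχ, χ.map_rel_iff,
    χ.map_rel_iff, χ.map_rel_iff, Ne, (Equiv.removeNone χ.toEquiv).apply_eq_iff_eq]

/-- Membership in a triple. -/
def in3 (a b c x : ℕ) : Bool := Nat.beq x a || Nat.beq x b || Nat.beq x c

/-- Adjacency after a `∇Y` move, the new vertex being `n`. -/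
def triB (n N a b c x y : ℕ) : Bool :=
  bif Nat.beq x n then !(Nat.beq y n) && in3 a b c y
  else bif Nat.beq y n then in3 a b c x
  else adj2 N x y && !(in3 a b c x && in3 a b c y)

/-- The entry codes an isomorphism from a `∇Y` move. -/
def entOK (e : ℕ × ℕ × ℕ × ℕ × ℕ × ℕ) : Bool :=
  match e with
  | (j, a, b, c, i, s) =>
    Nat.blt j 7 && Nat.blt i 7 && Nat.beq (pn i) (pn j + 1) &&
    Nat.blt a (pn j) && Nat.blt b (pn j) && Nat.blt c (pn j) &&
    adj2 (pN j) a b && adj2 (pN j) b c && adj2 (pN j) a c &&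
    allB (pn j + 1) fun x => Nat.blt (dg s x) (pn i) && allB (pn j + 1) fun y =>
      (Nat.beq x y || !(Nat.beq (dg s x) (dg s y))) &&
      (triB (pn j) (pN j) a b c x y == adj2 (pN i) (dg s x) (dg s y))

theorem in3_iff {a b c x : ℕ} : in3 a b c x = true ↔ (x = a ∨ x = b ∨ x = c) := by
  simp [in3, or_assoc]

theorem ent_spec {j a b c i s : ℕ} (h : entOK (j, a, b, c, i, s) = true) :
    j < 7 ∧ i < 7 ∧ ∃ a' b' c' : Fin (pn j), a'.val = a ∧ b'.val = b ∧ c'.val = c ∧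
      (pet j).Adj a' b' ∧ (pet j).Adj b' c' ∧ (pet j).Adj a' c' ∧
      ∃ χ : triangleY (pet j) a' b' c' ≃g pet i, (χ none).val = dg s (pn j) := by
  unfold entOK at h
  simp only [Bool.and_eq_true, nblt, nbeq, allB_iff, and_assoc, beq_iff_eq] at h
  obtain ⟨hj, hi, hn, ha, hb, hc, hab, hbc, hac, hx⟩ := h
  refine ⟨hj, hi, ⟨a, ha⟩, ⟨b, hb⟩, ⟨c, hc⟩, rfl, rfl, rfl, adj2_iff.1 hab, adj2_iff.1 hbc,
    adj2_iff.1 hac, ?_⟩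
  let t : Option (Fin (pn j)) → ℕ := fun o => o.elim (pn j) Fin.val
  have ht : ∀ o, t o < pn j + 1 := by
    intro o
    cases o with
    | none => exact Nat.lt_succ_self _
    | some x => exact Nat.lt_succ_of_lt x.2
  have hti : Function.Injective t := by
    intro o o' ho
    cases o with
    | none =>
      cases o' with
      | none => rfl
      | some y => exact absurd ho (Nat.ne_of_gt y.2)
    | some x =>
      cases o' with
      | none => exact absurd ho (Nat.ne_of_lt x.2)
      | some y => exact congrArg some (Fin.ext ho)
  let g : Option (Fin (pn j)) → Fin (pn i) := fun o => ⟨dg s (t o), (hx _ (ht o)).1⟩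
  have hg : Function.Injective g := by
    intro o o' ho
    have := ((hx _ (ht o)).2 _ (ht o')).1
    rw [Bool.or_eq_true, nbeq] at this
    rcases this with h | h
    · exact hti h
    · exfalso
      rw [nbeq.2 (Fin.ext_iff.1 ho)] at h
      simp at h
  have hbij : Function.Bijective g := by
    rw [Fintype.bijective_iff_injective_and_card]
    exact ⟨hg, by simp [hn]⟩
  refine ⟨⟨Equiv.ofBijective g hbij, ?_⟩, rfl⟩
  intro o o'
  change (cg (pn i) (pN i)).Adj (g o) (g o') ↔ _
  rw [← adj2_iff]
  have key := ((hx _ (ht o)).2 _ (ht o')).2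
  change adj2 (pN i) (dg s (t o)) (dg s (t o')) = true ↔ _
  rw [← key]
  have hlt : ∀ x : Fin (pn j), Nat.beq x (pn j) = false := by
    intro x
    rw [← Bool.not_eq_true, nbeq]
    exact Nat.ne_of_lt x.2
  cases o with
  | none =>
    cases o' with
    | none => simp [t, triB]
    | some y =>
      simp only [t, triB, Option.elim, nbeq.2, cond_true, hlt, Bool.not_false, Bool.true_and,
        in3_iff, triY_ns, Fin.ext_iff]
  | some x =>
    cases o' with
    | none =>
      rw [SimpleGraph.adj_comm]
      simp only [t, triB, Option.elim, nbeq.2, cond_true, cond_false, hlt, in3_iff, triY_ns,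
        Fin.ext_iff]
    | some y =>
      simp only [t, triB, Option.elim, cond_false, hlt, triY_ss, Fin.ext_iff, Bool.and_eq_true,
        Bool.not_eq_true', ← Bool.not_eq_true, in3_iff, adj2_iff]
      rfl

/-- Every triangle is in the list. -/
def triOK : Bool := allB 7 fun j => allB (pn j) fun a => allB (pn j) fun b =>
  bif adj2 (pN j) a b then allB (pn j) fun c =>
    bif adj2 (pN j) b c && adj2 (pN j) a c then
      yCerts.any fun e => match e with
        | (j', a', b', c', _, _) => Nat.beq j' j && in3 a' b' c' a && in3 a' b' c' b && in3 a' b' c' c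
    else true
  else true

/-- Every possible center of a `Y∇` move is in the list. -/
def yOK : Bool := allB 7 fun i => allB (pn i) fun v =>
  (yCerts.any fun e => match e with
    | (j, _, _, _, i', s) => Nat.beq i' i && Nat.beq (dg s (pn j)) v) ||
  (anyB (pn i) fun x => adj2 (pN i) v x && anyB (pn i) fun y => adj2 (pN i) v y && adj2 (pN i) x y) ||
  (anyB (pn i) fun x => adj2 (pN i) v x && anyB x fun y => adj2 (pN i) v y &&
    anyB y fun z => adj2 (pN i) v z && anyB z fun t => adj2 (pN i) v t)

theorem ents_true : yCerts.all entOK = true := by decide +kernel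
theorem triOK_true : triOK = true := by decide +kernel
theorem yOK_true : yOK = true := by decide +kernel

theorem closed_dY {j : ℕ} (hj : j < 7) {a b c : Fin (pn j)} (hab : (pet j).Adj a b)
    (hbc : (pet j).Adj b c) (hac : (pet j).Adj a c) :
    ∃ i < 7, Nonempty (triangleY (pet j) a b c ≃g pet i) := by
  have h := triOK_true
  unfold triOK at h
  simp only [allB_iff, bif_imp, Bool.and_eq_true, List.any_eq_true] at h
  obtain ⟨⟨j', a', b', c', i, s⟩, he, h2⟩ :=
    h j hj a a.2 b b.2 (adj2_iff.2 hab) c c.2 ⟨adj2_iff.2 hbc, adj2_iff.2 hac⟩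
  simp only [nbeq, in3_iff] at h2
  obtain ⟨⟨⟨rfl, h3⟩, h4⟩, h5⟩ := h2
  obtain ⟨-, hi, a₁, b₁, c₁, rfl, rfl, rfl, k1, k2, k3, χ, -⟩ :=
    ent_spec (List.all_eq_true.1 ents_true _ he)
  refine ⟨i, hi, ?_⟩
  simp only [← Fin.ext_iff] at h3 h4 h5
  have := hab.ne
  have := hbc.ne
  have := hac.ne
  obtain ⟨ψ⟩ := triY_congr (SimpleGraph.Iso.refl (G := pet j')) (a := a) (b := b) (c := c)
    (a' := a₁) (b' := b₁) (c' := c₁) (by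
      intro x
      change _ ↔ (x = a₁ ∨ x = b₁ ∨ x = c₁)
      grind)
  exact ⟨ψ.trans χ⟩

theorem closed_Yd {V : Type} {G : SimpleGraph V} {a b c : V} {i : ℕ} (hi : i < 7)
    (hab : G.Adj a b) (hbc : G.Adj b c) (hac : G.Adj a c)
    (φ : triangleY G a b c ≃g pet i) : ∃ j < 7, Nonempty (G ≃g pet j) := by
  have h := yOK_true
  unfold yOK at h
  simp only [allB_iff] at h
  have h := h i hi (φ none) (φ none).2
  have nb : ∀ x : Fin (pn i), adj2 (pN i) (φ none) x = true →
      ∃ p, x = φ (some p) ∧ (p = a ∨ p = b ∨ p = c) := by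
    intro x hx
    have hx : (pet i).Adj (φ none) x := adj2_iff.1 hx
    obtain ⟨o, rfl⟩ := φ.surjective x
    rw [φ.map_rel_iff] at hx
    cases o with
    | none => exact absurd hx triY_nn
    | some p => exact ⟨p, rfl, triY_ns.1 hx⟩
  rw [Bool.or_eq_true, Bool.or_eq_true] at h
  rcases h with (h | h) | h
  · rw [List.any_eq_true] at h
    obtain ⟨⟨j, a', b', c', i', s⟩, he, h2⟩ := h
    simp only [Bool.and_eq_true, nbeq] at h2
    obtain ⟨rfl, h3⟩ := h2
    obtain ⟨hj, -, a₁, b₁, c₁, -, -, -, k1, k2, k3, χ, hχ⟩ :=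
      ent_spec (List.all_eq_true.1 ents_true _ he)
    refine ⟨j, hj, triY_inv hab hbc hac k1 k2 k3 (φ.trans χ.symm) ?_⟩
    change χ.symm (φ none) = none
    have : φ none = χ none := Fin.ext (by rw [hχ, h3])
    rw [this]
    exact χ.symm_apply_apply none
  · exfalso
    simp only [anyB_iff, Bool.and_eq_true] at h
    obtain ⟨x, hx, h1, y, hy, h2, h3⟩ := h
    obtain ⟨p, hp, hpa⟩ := nb ⟨x, hx⟩ h1
    obtain ⟨q, hq, hqa⟩ := nb ⟨y, hy⟩ h2
    have h3 : (pet i).Adj ⟨x, hx⟩ ⟨y, hy⟩ := adj2_iff.1 h3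
    rw [hp, hq, φ.map_rel_iff, triY_ss] at h3
    exact h3.2 ⟨hpa, hqa⟩
  · exfalso
    simp only [anyB_iff, Bool.and_eq_true] at h
    obtain ⟨x, hx, h1, y, hy, h2, z, hz, h3, t, ht, h4⟩ := h
    obtain ⟨p, hp, hpa⟩ := nb ⟨x, hx⟩ h1
    obtain ⟨q, hq, hqa⟩ := nb ⟨y, by omega⟩ h2
    obtain ⟨r, hr, hra⟩ := nb ⟨z, by omega⟩ h3
    obtain ⟨u, hu, hua⟩ := nb ⟨t, by omega⟩ h4
    rw [Fin.ext_iff] at hp hq hr hu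
    simp only at hp hq hr hu
    have e1 : p ≠ q := by rintro rfl; omega
    have e2 : p ≠ r := by rintro rfl; omega
    have e3 : p ≠ u := by rintro rfl; omega
    have e4 : q ≠ r := by rintro rfl; omega
    have e5 : q ≠ u := by rintro rfl; omega
    have e6 : r ≠ u := by rintro rfl; omega
    grind

theorem k6_pet : Nonempty ((⊤ : SimpleGraph (Fin 6)) ≃g pet 0) := by
  refine ⟨⟨Equiv.refl _, ?_⟩⟩
  intro a b
  have : ∀ a b : Fin 6, (cg 6 (pN 0)).Adj a b ↔ a ≠ b := by decide +kernel
  exact this a b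

theorem family {W : Type} {P : SimpleGraph W} (h : IsPetersenFamily P) :
    ∃ i < 7, Nonempty (P ≃g pet i) := by
  induction h with
  | k6 => exact ⟨0, by norm_num, k6_pet⟩
  | @deltaY V G a b c _ hab hbc hac ih =>
    obtain ⟨j, hj, ⟨φ⟩⟩ := ih
    obtain ⟨i, hi, ⟨ψ⟩⟩ := closed_dY hj (φ.map_rel_iff.2 hab) (φ.map_rel_iff.2 hbc)
      (φ.map_rel_iff.2 hac)
    obtain ⟨χ⟩ := triY_congr φ (a := a) (b := b) (c := c) (a' := φ a) (b' := φ b) (c' := φ c)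
      (by intro x; simp)
    exact ⟨i, hi, ⟨χ.trans ψ⟩⟩
  | yDelta _ hab hbc hac ih =>
    obtain ⟨i, hi, ⟨φ⟩⟩ := ih
    exact closed_Yd hi hab hbc hac φ
  | iso _ e ih =>
    obtain ⟨i, hi, ⟨φ⟩⟩ := ih
    exact ⟨i, hi, ⟨e.symm.trans φ⟩⟩

theorem linkless_of {V : Type} {G : SimpleGraph V} (h : ∀ i < 7, ¬ IsMinor (pet i) G) :
    IsLinkless G := by
  intro W P hP hm
  obtain ⟨i, hi, ⟨φ⟩⟩ := family hP
  exact h i hi (minor_trans (minor_of_iso φ.symm) hm)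

theorem not_linkless_of {V : Type} {G : SimpleGraph V} (h : IsMinor (pet 0) G) :
    ¬ IsLinkless G := by
  intro hl
  obtain ⟨φ⟩ := k6_pet
  exact hl _ IsPetersenFamily.k6 (minor_trans (minor_of_iso φ) h)

/-! ### Connectivity checks -/

/-- Greedy construction of an elimination order. -/
def growL (N : ℕ) (l : List ℕ) : List ℕ :=
  l.foldl (fun acc x => bif acc.isEmpty || (!(acc.any (Nat.beq x)) && acc.any (adj2 N x))
    then x :: acc else acc) []

/-- The vertices below `n` other than `u` and `v`, in decreasing order. -/
def others (u v : ℕ) : ℕ → List ℕ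
  | 0 => []
  | n + 1 => bif Nat.beq n u || Nat.beq n v then others u v n else n :: others u v n

/-- Removing `u` and `v` leaves a connected graph. -/
def con2 (n N u v : ℕ) : Bool :=
  match growL N (others u v n ++ others u v n ++ others u v n) with
  | l => connL N l && (l.all fun x => Nat.blt x n) &&
      allB n fun x => (l.any (Nat.beq x)) == !(Nat.beq x u || Nat.beq x v)

theorem con2_spec {n N u v : ℕ} (h : con2 n N u v = true) :
    ((cg n N).induce {x : Fin n | x.val ≠ u ∧ x.val ≠ v}).Connected := by
  unfold con2 at h
  generalize growL N (others u v n ++ others u v n ++ others u v n) = l at h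
  simp only [Bool.and_eq_true, List.all_eq_true, nblt, allB_iff, beq_iff_eq] at h
  obtain ⟨⟨h1, h2⟩, h3⟩ := h
  have := connL_spec (n := n) l h1 h2
  have he : {x : Fin n | x.val ∈ l} = {x : Fin n | x.val ≠ u ∧ x.val ≠ v} := by
    ext x
    have := h3 x x.2
    rw [Bool.eq_iff_iff] at this
    simp only [List.any_eq_true, nbeq, Bool.not_eq_true', ← Bool.not_eq_true, Bool.or_eq_true] at this
    simp only [Set.mem_ofPred_eq]
    rw [← not_or, ← this]
    simp
  rwa [he] at this

theorem con3_true : (allB 7 fun i => allB (pn i + 1) fun u => allB (pn i + 1) fun v =>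
    con2 (pn i) (pN i) u v) = true := by decide +kernel

theorem con3 {i : ℕ} (hi : i < 7) {u v : ℕ} (hu : u < pn i + 1) (hv : v < pn i + 1) :
    ((pet i).induce {x : Fin (pn i) | x.val ≠ u ∧ x.val ≠ v}).Connected := by
  have h := con3_true
  simp only [allB_iff] at h
  exact con2_spec (h i hi u hu v hv)

theorem Q_con {c : Fin 13} (hc : c.val < 2) :
    ((cg 13 qN).induce {x : Fin 13 | x ≠ c}).Connected := by
  have h : allB 2 (fun c => con2 13 qN c c) = true := by decide +kernel
  rw [allB_iff] at h
  have := con2_spec (h c hc)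
  have he : {x : Fin 13 | x.val ≠ c ∧ x.val ≠ c} = {x : Fin 13 | x ≠ c} := by
    ext x
    simp [Fin.ext_iff]
  rwa [he] at this

/-! ### Adding an edge to `C₁₃(1,3)` -/

/-- The code of the graph with an added edge. -/
def addC (p q : ℕ) : ℕ :=
  Nat.lor qN (Nat.lor (Nat.shiftLeft 1 (16 * p + q)) (Nat.shiftLeft 1 (16 * q + p)))

theorem addC_ok : (allB 13 fun p => allB 13 fun q => allB 13 fun x => allB 13 fun y =>
    !(tb (addC p q) x y) || tb qN x y || (Nat.beq x p && Nat.beq y q) ||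
      (Nat.beq x q && Nat.beq y p)) = true := by decide +kernel

/-- The certificates give a `K₆` minor for every added edge. -/
def qmaxOK : Bool := allB 13 fun p => allB 13 fun q => Nat.beq p q || adj2 qN p q ||
  qCerts.any fun e => Nat.beq e.2.length 6 &&
    (mOK 13 (addC p q) (pN 0) (e.2.map fun l => l.map fun x => (x + p) % 13) ||
     mOK 13 (addC p q) (pN 0) (e.2.map fun l => l.map fun x => (x + q) % 13))

theorem qmaxOK_true : qmaxOK = true := by decide +kernel

theorem adj_addEdge {V : Type} {G : SimpleGraph V} {a b x y : V} : (addEdge G a b).Adj x y ↔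
    G.Adj x y ∨ (x ≠ y ∧ ((x = a ∧ y = b) ∨ (x = b ∧ y = a))) := by
  simp only [addEdge, SimpleGraph.sup_adj, SimpleGraph.fromEdgeSet_adj, Set.mem_singleton_iff,
    Sym2.eq_iff]
  tauto

theorem Q_max {p q : Fin 13} (hne : p ≠ q) (h : ¬ (cg 13 qN).Adj p q) :
    IsMinor (pet 0) (addEdge (cg 13 qN) p q) := by
  have hk := addC_ok
  simp only [allB_iff, Bool.or_eq_true, Bool.and_eq_true, nbeq, Bool.not_eq_true',
    ← Bool.not_eq_true] at hk
  have hk := hk p p.2 q q.2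
  have hsub : IsMinor (cg 13 (addC p q)) (addEdge (cg 13 qN) p q) := by
    refine minor_of_inj id Function.injective_id ?_
    intro x y hxy
    rw [adj_addEdge]
    have h1 := hk x x.2 y y.2
    have h2 := hk y y.2 x x.2
    simp only [hxy.2.1, hxy.2.2, not_true, false_or, ← Fin.ext_iff] at h1 h2
    by_cases hx : (x = p ∧ y = q) ∨ (x = q ∧ y = p)
    · exact Or.inr ⟨hxy.1, hx⟩
    · left
      refine ⟨hxy.1, ?_, ?_⟩
      · rcases h1 with (h1 | h1) | h1
        · exact h1
        · exact absurd (Or.inl h1) hx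
        · exact absurd (Or.inr h1) hx
      · rcases h2 with (h1 | h1) | h1
        · exact h1
        · exact absurd (Or.inr h1.symm) hx
        · exact absurd (Or.inl h1.symm) hx
  refine minor_trans ?_ hsub
  have hq := qmaxOK_true
  unfold qmaxOK at hq
  simp only [allB_iff] at hq
  have hq := hq p p.2 q q.2
  rw [Bool.or_eq_true, Bool.or_eq_true, nbeq, adj2_iff, ← Fin.ext_iff] at hq
  rcases hq with (hq | hq) | hq
  · exact absurd hq hne
  · exact absurd hq h
  · simp only [List.any_eq_true, Bool.and_eq_true, Bool.or_eq_true, nbeq] at hq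
    obtain ⟨e, -, hl, hm⟩ := hq
    have fin : ∀ t : ℕ, mOK 13 (addC p q) (pN 0) (e.2.map fun l => l.map fun x => (x + t) % 13) = true →
        IsMinor (cg 6 (pN 0)) (cg 13 (addC p q)) := by
      intro t ht
      have hmod := mOK_spec ht
      have hlen : (e.2.map fun l => l.map fun x => (x + t) % 13).length = 6 := by simp [hl]
      revert hmod
      generalize (e.2.map fun l => l.map fun x => (x + t) % 13) = B at hlen
      intro hmod
      rw [hlen] at hmod
      exact ⟨_, hmod⟩
    rcases hm with hm | hm
    · exact fin _ hm
    · exact fin _ hm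

theorem Q_tri (a b c : Fin 13) : ¬ ((cg 13 qN).Adj a b ∧ (cg 13 qN).Adj b c ∧ (cg 13 qN).Adj a c) := by
  have h : (allB 13 fun a => allB 13 fun b => allB 13 fun c =>
    !(adj2 qN a b && adj2 qN b c && adj2 qN a c)) = true := by decide +kernel
  simp only [allB_iff] at h
  have := h a a.2 b b.2 c c.2
  simp only [Bool.not_eq_true', ← Bool.not_eq_true, Bool.and_eq_true, adj2_iff, and_assoc] at this
  exact this

/-! ### Gluing copies of `C₁₃(1,3)` along an edge -/

/-- Vertices: the two base vertices and `11` further vertices in every block. -/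
abbrev GV (k : ℕ) : Type := Fin 2 ⊕ (Fin k × Fin 11)

/-- The name of a vertex in its copy. -/
def loc {k : ℕ} : GV k → Fin 13
  | Sum.inl a => ⟨a.val, by omega⟩
  | Sum.inr p => ⟨p.2.val + 2, by omega⟩

/-- Two vertices lie in a common copy. -/
def sameB {k : ℕ} : GV k → GV k → Prop
  | Sum.inr p, Sum.inr q => p.1 = q.1
  | _, _ => True

theorem sameB_symm {k : ℕ} {u v : GV k} (h : sameB u v) : sameB v u := by
  cases u <;> cases v <;> first | trivial | exact Eq.symm h

/-- `k` copies glued along an edge. -/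
def gk (k : ℕ) : SimpleGraph (GV k) where
  Adj u v := (cg 13 qN).Adj (loc u) (loc v) ∧ sameB u v
  symm := ⟨fun _ _ h => ⟨h.1.symm, sameB_symm h.2⟩⟩
  loopless := ⟨fun _ h => h.1.ne rfl⟩

/-- The copy number `i`. -/
def emb {k : ℕ} (i : Fin k) (x : Fin 13) : GV k :=
  if hx : x.val < 2 then Sum.inl ⟨x, hx⟩ else Sum.inr (i, ⟨x.val - 2, by omega⟩)

theorem emb_lt {k : ℕ} (i : Fin k) {x : Fin 13} (hx : x.val < 2) : emb i x = Sum.inl ⟨x, hx⟩ := by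
  simp [emb, hx]

theorem emb_ge {k : ℕ} (i : Fin k) {x : Fin 13} (hx : ¬ x.val < 2) :
    emb i x = Sum.inr (i, ⟨x.val - 2, by omega⟩) := by
  simp [emb, hx]

theorem loc_emb {k : ℕ} (i : Fin k) (x : Fin 13) : loc (emb i x) = x := by
  by_cases hx : x.val < 2
  · rw [emb_lt i hx]; rfl
  · rw [emb_ge i hx]
    apply Fin.ext
    simp only [loc]
    omega

theorem emb_inj {k : ℕ} (i : Fin k) : Function.Injective (emb i) := by
  intro x y h
  rw [← loc_emb i x, h, loc_emb]

theorem emb_loc_inl {k : ℕ} (i : Fin k) (a : Fin 2) : emb i (loc (Sum.inl a : GV k)) = Sum.inl a := by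
  rw [emb_lt i (show (loc (Sum.inl a : GV k)).val < 2 from a.2)]
  rfl

theorem emb_loc_inr {k : ℕ} (p : Fin k × Fin 11) : emb p.1 (loc (Sum.inr p)) = Sum.inr p := by
  rw [emb_ge p.1 (show ¬ (loc (Sum.inr p : GV k)).val < 2 by simp [loc])]
  simp [loc]

theorem sameB_emb {k : ℕ} (i : Fin k) (x y : Fin 13) : sameB (emb i x) (emb i y) := by
  unfold emb
  split <;> split <;> trivial

theorem adj_emb {k : ℕ} {i : Fin k} {x y : Fin 13} :
    (gk k).Adj (emb i x) (emb i y) ↔ (cg 13 qN).Adj x y := by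
  change ((cg 13 qN).Adj (loc (emb i x)) (loc (emb i y)) ∧ sameB (emb i x) (emb i y)) ↔ _
  rw [loc_emb, loc_emb]
  exact ⟨fun h => h.1, fun h => ⟨h, sameB_emb i x y⟩⟩

theorem gk_tri {k : ℕ} (a b c : GV k) : ¬ ((gk k).Adj a b ∧ (gk k).Adj b c ∧ (gk k).Adj a c) :=
  fun h => Q_tri _ _ _ ⟨h.1.1, h.2.1.1, h.2.2.1⟩

theorem Q01 : (cg 13 qN).Adj 0 1 := by decide +kernel

theorem exists_index {k n : ℕ} {f : Fin n → Set (GV k)}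
    (hf : Pairwise fun w₁ w₂ => Disjoint (f w₁) (f w₂)) (z : GV k) :
    ∃ u < n + 1, ∀ w : Fin n, z ∈ f w ↔ w.val = u := by
  by_cases h : ∃ w, z ∈ f w
  · obtain ⟨w, hw⟩ := h
    refine ⟨w, by omega, fun w' => ⟨fun h' => ?_, fun h' => ?_⟩⟩
    · by_contra hne
      exact Set.disjoint_left.1 (hf (fun e => hne (by rw [e]) : w' ≠ w)) h' hw
    · rw [Fin.ext h']; exact hw
  · push Not at h
    exact ⟨n, by omega, fun w => ⟨fun h' => absurd h' (h w), fun h' => absurd h' (by omega)⟩⟩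

theorem gk_no_pet {k i : ℕ} (hi : i < 7) : ¬ IsMinor (pet i) (gk k) := by
  classical
  rintro ⟨f, f1, f2, f3, f4⟩
  obtain ⟨u, hu, hu'⟩ := exists_index f3 (Sum.inl 0)
  obtain ⟨v, hv, hv'⟩ := exists_index f3 (Sum.inl 1)
  have hcon := con3 hi hu hv
  have hno : ∀ w : Fin (pn i), w.val ≠ u ∧ w.val ≠ v → ∀ x ∈ f w, ∃ p, x = Sum.inr p := by
    intro w hw x hx
    rcases x with a | p
    · exfalso
      fin_cases a
      · exact hw.1 ((hu' w).1 hx)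
      · exact hw.2 ((hv' w).1 hx)
    · exact ⟨p, rfl⟩
  have blk : ∀ w : Fin (pn i), w.val ≠ u ∧ w.val ≠ v → ∀ p, Sum.inr p ∈ f w →
      ∀ x ∈ f w, ∃ b, x = Sum.inr (p.1, b) := by
    intro w hw p hp x hx
    refine conn_ind (f2 w) (fun x => ∃ b, x = Sum.inr (p.1, b)) ?_ hp hx ⟨p.2, rfl⟩
    rintro _ - y hy hxy ⟨b, rfl⟩
    obtain ⟨q, rfl⟩ := hno w hw y hy
    have : p.1 = q.1 := hxy.2
    exact ⟨q.2, by rw [this]⟩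
  obtain ⟨⟨s, hs⟩⟩ := hcon.nonempty
  obtain ⟨x₀, hx₀⟩ := f1 s
  obtain ⟨p₀, rfl⟩ := hno s hs x₀ hx₀
  set i₀ := p₀.1 with hi₀
  have all : ∀ w : Fin (pn i), w.val ≠ u ∧ w.val ≠ v → ∀ x ∈ f w, ∃ b, x = Sum.inr (i₀, b) := by
    intro w hw
    refine conn_ind hcon (fun w => ∀ x ∈ f w, ∃ b, x = Sum.inr (i₀, b)) ?_ hs hw
      (blk s hs p₀ hx₀)
    intro a ha b hb hab h
    obtain ⟨x, hx, y, hy, hxy⟩ := f4 hab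
    obtain ⟨c, rfl⟩ := h x hx
    obtain ⟨q, rfl⟩ := hno b hb y hy
    have hq : i₀ = q.1 := hxy.2
    rw [hq]
    exact blk b hb q hy
  let r : Fin (pn i) → GV k → Fin 13 := fun w x =>
    match x with
    | Sum.inl a => loc (Sum.inl a : GV k)
    | Sum.inr p => if p.1 = i₀ then loc (Sum.inr p) else if Sum.inl 0 ∈ f w then 0 else 1
  have hr : ∀ w x, x ∈ f w → (x = emb i₀ (r w x)) ∨
      ((∃ p : Fin k × Fin 11, x = Sum.inr p ∧ p.1 ≠ i₀) ∧
        (((Sum.inl 0 : GV k) ∈ f w ∧ r w x = 0) ∨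
          ((Sum.inl 0 : GV k) ∉ f w ∧ (Sum.inl 1 : GV k) ∈ f w ∧ r w x = 1))) := by
    intro w x hx
    rcases x with a | p
    · left
      exact (emb_loc_inl i₀ a).symm
    · by_cases hp : p.1 = i₀
      · left
        simp only [r, hp, if_true]
        rw [← hp]
        exact (emb_loc_inr p).symm
      · right
        refine ⟨⟨p, rfl, hp⟩, ?_⟩
        by_cases h0 : (Sum.inl 0 : GV k) ∈ f w
        · left
          exact ⟨h0, by simp [r, hp, h0]⟩
        · right
          refine ⟨h0, ?_, by simp [r, hp, h0]⟩
          by_contra h1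
          obtain ⟨b, hb⟩ := all w ⟨fun e => h0 ((hu' w).2 e), fun e => h1 ((hv' w).2 e)⟩ _ hx
          rw [Sum.inr.injEq] at hb
          exact hp (by rw [hb])
  have e0 : emb i₀ 0 = Sum.inl 0 := emb_lt i₀ (by norm_num)
  have e1 : emb i₀ 1 = Sum.inl 1 := emb_lt i₀ (by norm_num)
  have hmem : ∀ w x, x ∈ f w → emb i₀ (r w x) ∈ f w := by
    intro w x hx
    rcases hr w x hx with h | ⟨-, ⟨h0, h⟩ | ⟨-, h1, h⟩⟩
    · rwa [← h]
    · rw [h, e0]; exact h0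
    · rw [h, e1]; exact h1
  have hsame : ∀ w, ∀ z, emb i₀ z ∈ f w → r w (emb i₀ z) = z := by
    intro w z hz
    rcases hr w _ hz with h | ⟨⟨p, h, hp⟩, -⟩
    · exact (emb_inj i₀ h).symm
    · exfalso
      by_cases hx : z.val < 2
      · rw [emb_lt i₀ hx] at h; simp at h
      · rw [emb_ge i₀ hx, Sum.inr.injEq] at h
        exact hp (by rw [← h])
  -- the outside vertices
  have hout : ∀ w x y, x ∈ f w → (gk k).Adj x y →
      (∃ p : Fin k × Fin 11, x = Sum.inr p ∧ p.1 ≠ i₀) →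
      (∃ a, y = Sum.inl a) ∨ (∃ p : Fin k × Fin 11, y = Sum.inr p ∧ p.1 ≠ i₀) := by
    rintro w _ y hx hxy ⟨p, rfl, hp⟩
    rcases y with a | q
    · exact Or.inl ⟨a, rfl⟩
    · have : p.1 = q.1 := hxy.2
      exact Or.inr ⟨q, rfl, this ▸ hp⟩
  have hbase : ∀ w x, x ∈ f w → ((∃ a, x = Sum.inl a) ∨
      (∃ p : Fin k × Fin 11, x = Sum.inr p ∧ p.1 ≠ i₀)) →
      (Sum.inl 0 : GV k) ∈ f w ∨ (Sum.inl 1 : GV k) ∈ f w := by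
    rintro w x hx (⟨a, rfl⟩ | ⟨p, rfl, hp⟩)
    · fin_cases a
      · exact Or.inl hx
      · exact Or.inr hx
    · rcases hr w _ hx with h | ⟨-, ⟨h0, h⟩ | ⟨-, h1, h⟩⟩
      · exfalso
        by_cases hz : (r w (Sum.inr p)).val < 2
        · rw [emb_lt i₀ hz] at h; simp at h
        · rw [emb_ge i₀ hz, Sum.inr.injEq] at h
          exact hp (by rw [h])
      · exact Or.inl h0
      · exact Or.inr h1
  refine Q_no_pet hi ⟨fun w => r w '' f w, fun w => (f1 w).image _, fun w => ?_, ?_, ?_⟩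
  · refine conn_image (f2 w) (r w) ?_
    have half : ∀ a ∈ f w, ∀ b ∈ f w, (gk k).Adj a b →
        (∃ p : Fin k × Fin 11, a = Sum.inr p ∧ p.1 ≠ i₀) →
        r w a = r w b ∨ (cg 13 qN).Adj (r w a) (r w b) := by
      intro a ha b hb hab hp
      rcases hout w a b ha hab hp with ⟨c, rfl⟩ | hq
      · obtain ⟨p, rfl, hp⟩ := hp
        have hrb : r w (Sum.inl c) = loc (Sum.inl c : GV k) := rfl
        rw [hrb]
        by_cases h0 : (Sum.inl 0 : GV k) ∈ f w
        · have : r w (Sum.inr p) = 0 := by simp [r, hp, h0]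
          rw [this]
          fin_cases c
          · exact Or.inl rfl
          · exact Or.inr Q01
        · have : r w (Sum.inr p) = 1 := by simp [r, hp, h0]
          rw [this]
          fin_cases c
          · exact absurd hb h0
          · exact Or.inl rfl
      · obtain ⟨p, rfl, hp⟩ := hp
        obtain ⟨q, rfl, hq⟩ := hq
        left
        simp [r, hp, hq]
    intro a ha b hb hab
    rcases hr w a ha with h | ⟨h, -⟩
    · rcases hr w b hb with h' | ⟨h', -⟩
      · right
        rw [h, h', adj_emb] at hab
        exact hab
      · exact (half b hb a ha hab.symm h').imp Eq.symm SimpleGraph.Adj.symm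
    · exact half a ha b hb hab h
  · intro w w' hw
    rw [Set.disjoint_left]
    rintro _ ⟨a, ha, rfl⟩ ⟨b, hb, hab⟩
    have h1 := hmem w a ha
    have h2 := hmem w' b hb
    rw [hab] at h2
    exact Set.disjoint_left.1 (f3 hw) h1 h2
  · intro w w' hw
    obtain ⟨a, ha, b, hb, hab⟩ := f4 hw
    have fin : ((Sum.inl 0 : GV k) ∈ f w ∨ (Sum.inl 1 : GV k) ∈ f w) →
        ((Sum.inl 0 : GV k) ∈ f w' ∨ (Sum.inl 1 : GV k) ∈ f w') →
        ∃ v₁ ∈ r w '' f w, ∃ v₂ ∈ r w' '' f w', (cg 13 qN).Adj v₁ v₂ := by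
      have hd := Set.disjoint_left.1 (f3 hw.ne)
      rintro (h | h) (h' | h')
      · exact absurd h' (hd h)
      · exact ⟨_, ⟨_, h, rfl⟩, _, ⟨_, h', rfl⟩, Q01⟩
      · exact ⟨_, ⟨_, h, rfl⟩, _, ⟨_, h', rfl⟩, Q01.symm⟩
      · exact absurd h' (hd h)
    rcases hr w a ha with h | ⟨h, -⟩
    · rcases hr w' b hb with h' | ⟨h', -⟩
      · refine ⟨_, ⟨a, ha, rfl⟩, _, ⟨b, hb, rfl⟩, ?_⟩
        rw [h, h', adj_emb] at hab
        exact hab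
      · exact fin (hbase w a ha (hout w' b a hb hab.symm h')) (hbase w' b hb (Or.inr h'))
    · exact fin (hbase w a ha (Or.inr h)) (hbase w' b hb (hout w a b ha hab h))

theorem gk_linkless (k : ℕ) : IsLinkless (gk k) := linkless_of fun _ hi => gk_no_pet hi

theorem gk_max_same {k : ℕ} (i : Fin k) {p q : Fin 13} (hne : p ≠ q) (h : ¬ (cg 13 qN).Adj p q) :
    IsMinor (pet 0) (addEdge (gk k) (emb i p) (emb i q)) := by
  refine minor_trans (Q_max hne h) (minor_of_inj (emb i) (emb_inj i) ?_)
  intro x y hxy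
  rw [adj_addEdge] at hxy ⊢
  rcases hxy with hxy | ⟨hn, hxy⟩
  · exact Or.inl (adj_emb.2 hxy)
  · right
    refine ⟨fun e => hn (emb_inj i e), ?_⟩
    rcases hxy with ⟨rfl, rfl⟩ | ⟨rfl, rfl⟩
    · exact Or.inl ⟨rfl, rfl⟩
    · exact Or.inr ⟨rfl, rfl⟩

theorem gk_max_diff {k : ℕ} (i j : Fin k) (hij : i ≠ j) {p q : Fin 13} (hp : ¬ p.val < 2)
    (hq : ¬ q.val < 2) : IsMinor (pet 0) (addEdge (gk k) (emb i p) (emb j q)) := by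
  have hc : ∃ c c' : Fin 13, c.val < 2 ∧ c'.val < 2 ∧ (∀ x : Fin 13, x.val < 2 → x = c ∨ x = c') ∧
      c ≠ c' ∧ ¬ (cg 13 qN).Adj p c := by
    have hcov : ∀ x : Fin 13, x.val < 2 → x = 0 ∨ x = 1 := by decide
    by_cases h : (cg 13 qN).Adj p 0
    · exact ⟨1, 0, by norm_num, by norm_num, fun x hx => (hcov x hx).symm, by decide,
        fun h' => Q_tri p 0 1 ⟨h, Q01, h'⟩⟩
    · exact ⟨0, 1, by norm_num, by norm_num, hcov, by decide, h⟩
  obtain ⟨c, c', h1, h2, h3, h4, h5⟩ := hc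
  have hpc : p ≠ c := fun e => hp (e ▸ h1)
  refine minor_trans (Q_max hpc h5) ?_
  have hec : emb i c = emb j c := by rw [emb_lt i h1, emb_lt j h1]
  have hF : ∀ x, emb i x ∈ (if x = c then emb j '' {y | y ≠ c'} else {emb i x} : Set (GV k)) := by
    intro x
    split
    · rename_i hx
      subst hx
      exact ⟨x, h4, hec.symm⟩
    · rfl
  have hdis : ∀ x, x ≠ c → emb i x ∉ emb j '' {y | y ≠ c'} := by
    rintro x hx ⟨y, hy, hxy⟩
    have hyx : y = x := by rw [← loc_emb j y, hxy, loc_emb]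
    subst hyx
    by_cases hlt : y.val < 2
    · rcases h3 y hlt with h | h
      · exact hx h
      · exact hy h
    · rw [emb_ge i hlt, emb_ge j hlt, Sum.inr.injEq, Prod.mk.injEq] at hxy
      exact hij hxy.1.symm
  refine ⟨fun x => if x = c then emb j '' {y | y ≠ c'} else {emb i x}, fun x => ⟨_, hF x⟩, ?_, ?_, ?_⟩
  · intro x
    by_cases hx : x = c
    · rw [show (fun x => if x = c then emb j '' {y | y ≠ c'} else {emb i x} : Fin 13 → Set (GV k)) x =
        emb j '' {y | y ≠ c'} from if_pos hx]
      refine conn_image (Q_con h2) (emb j) ?_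
      intro a _ b _ hab
      right
      rw [adj_addEdge]
      exact Or.inl (adj_emb.2 hab)
    · rw [show (fun x => if x = c then emb j '' {y | y ≠ c'} else {emb i x} : Fin 13 → Set (GV k)) x =
        {emb i x} from if_neg hx]
      exact conn_singleton _ _
  · intro x y hxy
    by_cases hx : x = c
    · have hy : y ≠ c := fun e => hxy (hx.trans e.symm)
      simp only [hx, hy, if_true, if_false]
      rw [Set.disjoint_singleton_right]
      exact hdis y hy
    · by_cases hy : y = c
      · simp only [hx, hy, if_true, if_false]
        rw [Set.disjoint_singleton_left]
        exact hdis x hx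
      · simp only [hx, hy, if_false]
        rw [Set.disjoint_singleton]
        exact fun e => hxy (emb_inj i e)
  · intro x y hxy
    rw [adj_addEdge] at hxy
    have hqm : emb j q ∈ (if c = c then emb j '' {y | y ≠ c'} else {emb i c} : Set (GV k)) := by
      rw [if_pos rfl]
      exact ⟨q, fun e => hq (e ▸ h2), rfl⟩
    have hnn : emb i p ≠ emb j q := by
      rw [emb_ge i hp, emb_ge j hq]
      intro e
      rw [Sum.inr.injEq, Prod.mk.injEq] at e
      exact hij e.1
    rcases hxy with hxy | ⟨hn, ⟨rfl, rfl⟩ | ⟨rfl, rfl⟩⟩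
    · exact ⟨_, hF x, _, hF y, adj_addEdge.2 (Or.inl (adj_emb.2 hxy))⟩
    · exact ⟨_, hF x, _, hqm, adj_addEdge.2 (Or.inr ⟨hnn, Or.inl ⟨rfl, rfl⟩⟩)⟩
    · exact ⟨_, hqm, _, hF y, adj_addEdge.2 (Or.inr ⟨hnn.symm, Or.inr ⟨rfl, rfl⟩⟩)⟩

theorem gk_max {k : ℕ} (hk : 1 ≤ k) {a b : GV k} (hne : a ≠ b) (h : ¬ (gk k).Adj a b) :
    IsMinor (pet 0) (addEdge (gk k) a b) := by
  have same : ∀ i : Fin k, emb i (loc a) = a → emb i (loc b) = b →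
      IsMinor (pet 0) (addEdge (gk k) a b) := by
    intro i ha hb
    have := gk_max_same i (p := loc a) (q := loc b)
      (fun e => hne (by rw [← ha, ← hb, e])) (by rw [← adj_emb (i := i), ha, hb]; exact h)
    rwa [ha, hb] at this
  rcases a with a | p
  · rcases b with b | q
    · exact same ⟨0, hk⟩ (emb_loc_inl _ _) (emb_loc_inl _ _)
    · exact same q.1 (emb_loc_inl _ _) (emb_loc_inr _)
  · rcases b with b | q
    · exact same p.1 (emb_loc_inr _) (emb_loc_inl _ _)
    · by_cases hpq : p.1 = q.1
      · exact same p.1 (emb_loc_inr _) (by rw [hpq]; exact emb_loc_inr _)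
      · have := gk_max_diff p.1 q.1 hpq (p := loc (Sum.inr p : GV k)) (q := loc (Sum.inr q : GV k))
          (by simp [loc]) (by simp [loc])
        rwa [emb_loc_inr, emb_loc_inr] at this

theorem gk_maxnil {k : ℕ} (hk : 1 ≤ k) : IsMaxnil (gk k) :=
  ⟨gk_linkless k, fun _ _ hne h => not_linkless_of (gk_max hk hne h)⟩

instance sameBDec {k : ℕ} : (u v : GV k) → Decidable (sameB u v)
  | Sum.inr p, Sum.inr q => inferInstanceAs (Decidable (p.1 = q.1))
  | Sum.inl _, Sum.inl _ => isTrue trivial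
  | Sum.inl _, Sum.inr _ => isTrue trivial
  | Sum.inr _, Sum.inl _ => isTrue trivial

instance gkDec (k : ℕ) : DecidableRel (gk k).Adj := fun u v =>
  inferInstanceAs (Decidable ((cg 13 qN).Adj (loc u) (loc v) ∧ sameB u v))

theorem deg_inl {k : ℕ} (a : Fin 2) : (gk k).degree (Sum.inl a) = 1 + 3 * k := by
  have h1 : ∀ a : Fin 2, (∑ b : Fin 2, if (cg 13 qN).Adj (loc (Sum.inl a : GV 0))
      (loc (Sum.inl b : GV 0)) then 1 else 0) = 1 := by decide +kernel
  have h2 : ∀ a : Fin 2, (∑ b : Fin 11, if (cg 13 qN).Adj (loc (Sum.inl a : GV 0))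
      ⟨b.val + 2, by omega⟩ then 1 else 0) = 3 := by decide +kernel
  rw [← SimpleGraph.card_neighborFinset_eq_degree, SimpleGraph.neighborFinset_eq_filter,
    Finset.card_filter, Fintype.sum_sum_type, Fintype.sum_prod_type]
  have e1 : (∑ b : Fin 2, if (gk k).Adj (Sum.inl a) (Sum.inl b) then 1 else 0) = 1 := by
    refine Eq.trans ?_ (h1 a)
    refine Finset.sum_congr rfl fun b _ => if_congr ?_ rfl rfl
    exact ⟨fun h => h.1, fun h => ⟨h, trivial⟩⟩
  have e2 : ∀ i : Fin k, (∑ b : Fin 11, if (gk k).Adj (Sum.inl a) (Sum.inr (i, b)) then 1 else 0)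
      = 3 := by
    intro i
    refine Eq.trans ?_ (h2 a)
    refine Finset.sum_congr rfl fun b _ => if_congr ?_ rfl rfl
    exact ⟨fun h => h.1, fun h => ⟨h, trivial⟩⟩
  rw [e1, Finset.sum_congr rfl fun i _ => e2 i]
  simp [mul_comm]

theorem deg_inr {k : ℕ} (p : Fin k × Fin 11) : (gk k).degree (Sum.inr p) = 4 := by
  obtain ⟨j, c⟩ := p
  have h1 : ∀ c : Fin 11, (∑ b : Fin 2, if (cg 13 qN).Adj ⟨c.val + 2, by omega⟩
      (loc (Sum.inl b : GV 0)) then 1 else 0) + (∑ b : Fin 11, if (cg 13 qN).Adj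
      ⟨c.val + 2, by omega⟩ ⟨b.val + 2, by omega⟩ then 1 else 0) = 4 := by decide +kernel
  rw [← SimpleGraph.card_neighborFinset_eq_degree, SimpleGraph.neighborFinset_eq_filter,
    Finset.card_filter, Fintype.sum_sum_type, Fintype.sum_prod_type, ← h1 c]
  congr 1
  · refine Finset.sum_congr rfl fun b _ => if_congr ?_ rfl rfl
    exact ⟨fun h => h.1, fun h => ⟨h, trivial⟩⟩
  · rw [Finset.sum_eq_single j]
    · refine Finset.sum_congr rfl fun b _ => if_congr ?_ rfl rfl
      exact ⟨fun h => h.1, fun h => ⟨h, rfl⟩⟩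
    · intro i _ hij
      refine Finset.sum_eq_zero fun b _ => if_neg fun h => ?_
      have : j = i := h.2
      exact hij this.symm
    · intro h
      exact absurd (Finset.mem_univ j) h

theorem gk_edges (k : ℕ) : (gk k).edgeSet.ncard = 25 * k + 1 := by
  have h := (gk k).sum_degrees_eq_twice_card_edges
  rw [Fintype.sum_sum_type, Finset.sum_congr rfl fun a _ => deg_inl (k := k) a,
    Finset.sum_congr rfl fun a _ => deg_inr (k := k) a] at h
  simp only [Finset.sum_const, Finset.card_univ, Fintype.card_prod, Fintype.card_fin,
    smul_eq_mul] at h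
  rw [← SimpleGraph.coe_edgeFinset, Set.ncard_coe_finset]
  omega

theorem linkless_iso {V V' : Type} {G : SimpleGraph V} {G' : SimpleGraph V'} (φ : G ≃g G')
    (h : IsLinkless G') : IsLinkless G :=
  fun _ P hP hm => h P hP (minor_trans hm (minor_of_iso φ))

theorem maxnil_iso {V V' : Type} {G : SimpleGraph V} {G' : SimpleGraph V'} (φ : G ≃g G')
    (h : IsMaxnil G') : IsMaxnil G := by
  refine ⟨linkless_iso φ h.1, fun a b hne hab hl => ?_⟩
  refine h.2 (φ a) (φ b) (fun e => hne (φ.injective e)) (fun e => hab (φ.map_rel_iff.1 e)) ?_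
  have ψ : addEdge G a b ≃g addEdge G' (φ a) (φ b) := by
    refine ⟨φ.toEquiv, ?_⟩
    intro x y
    change (addEdge G' (φ a) (φ b)).Adj (φ x) (φ y) ↔ _
    rw [adj_addEdge, adj_addEdge, φ.map_rel_iff]
    simp
  exact linkless_iso ψ.symm hl

/-- For every `k ≥ 1` there exists a maxnil graph with `11k + 2` vertices and
`25k + 1` edges in which no edge lies in a triangle. -/
theorem stmt_2 (k : ℕ) (hk : 1 ≤ k) :
    ∃ G : SimpleGraph (Fin (11 * k + 2)),
      IsMaxnil G ∧ G.edgeSet.ncard = 25 * k + 1 ∧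
      ∀ a b c : Fin (11 * k + 2), ¬ (G.Adj a b ∧ G.Adj b c ∧ G.Adj a c) := by
  have hcard : Fintype.card (Fin (11 * k + 2)) = Fintype.card (GV k) := by
    simp; omega
  let e : Fin (11 * k + 2) ≃ GV k := Fintype.equivOfCardEq hcard
  let φ : (gk k).comap e ≃g gk k := SimpleGraph.Iso.comap e (gk k)
  refine ⟨(gk k).comap e, maxnil_iso φ (gk_maxnil hk), ?_, ?_⟩
  · rw [← gk_edges k]
    exact Nat.card_congr φ.mapEdgeSet
  · intro a b c h
    exact gk_tri (e a) (e b) (e c) h
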